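/- Let S be a cap in F = (Fin 6 → ZMod 3) and let ℓ : F → ZMod 3 be a nonzero linear functional such that the slices S ∩ ℓ⁻¹(1) and S ∩ ℓ⁻¹(2) each have exactly 45 points. If there exists c ∈ F with ℓ(c) = 0 such that S ∩ ℓ⁻¹(2) = { c − x : x ∈ S ∩ ℓ⁻¹(1) } (the two 45-point slices are point reflections of each other), then the slice S ∩ ℓ⁻¹(0) has at most 22 points, and S is contained in a cap of size 112. -/

import Mathlib

/-- A cap in the `n`-dimensional affine space over the field of three elements. -/
def IsCap {n : ℕ} (S : Finset (Fin n → ZMod 3)) : Prop :=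
  ∀ a ∈ S, ∀ b ∈ S, ∀ c ∈ S, a ≠ b → a ≠ c → b ≠ c → a + b + c ≠ 0

open Finset

section Flats

variable {W : Type*} [AddCommGroup W]

/-- Caps in a vector space over the field of three elements. -/
def CapFree (B : Finset W) : Prop :=
  ∀ a ∈ B, ∀ b ∈ B, ∀ c ∈ B, a ≠ b → a ≠ c → b ≠ c → a + b + c ≠ 0

theorem CapFree.mono {B C : Finset W} (hB : CapFree B) (h : C ⊆ B) : CapFree C :=
  fun a ha b hb c hc => hB a (h ha) b (h hb) c (h hc)

variable [Module (ZMod 3) W]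

/-- The number of points of `B` on which the functional `ψ` takes the value `j`. -/
def levelCard (B : Finset W) (ψ : Module.Dual (ZMod 3) W) (j : ZMod 3) : ℕ :=
  #{x ∈ B | ψ x = j}

/-- The part of `B` on which the functional `ψ` takes the value `j`. -/
def level (B : Finset W) (ψ : Module.Dual (ZMod 3) W) (j : ZMod 3) : Finset W :=
  {x ∈ B | ψ x = j}

/-- All functionals in `U` are constant on `B`. -/
def Flat (U : Submodule (ZMod 3) (Module.Dual (ZMod 3) W)) (B : Finset W) : Prop :=
  ∀ u ∈ U, ∀ x ∈ B, ∀ y ∈ B, u x = u y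

/-- The subspace of functionals spanned by `U` and `ψ`. -/
def adj (U : Submodule (ZMod 3) (Module.Dual (ZMod 3) W)) (ψ : Module.Dual (ZMod 3) W) :
    Submodule (ZMod 3) (Module.Dual (ZMod 3) W) :=
  U ⊔ Submodule.span (ZMod 3) {ψ}

variable {U : Submodule (ZMod 3) (Module.Dual (ZMod 3) W)} {B C : Finset W}
  {φ χ ψ : Module.Dual (ZMod 3) W}

theorem three_nsmul_eq_zero' (x : W) : x + x + x = 0 := by
  have h : (3 : ZMod 3) • x = x + x + x := by
    rw [show (3 : ZMod 3) = 1 + 1 + 1 by rfl, add_smul, add_smul, one_smul]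
  rw [← h, show (3 : ZMod 3) = 0 by rfl, zero_smul]

theorem CapFree.eq_of_add_eq_zero (hB : CapFree B) {a b c : W} (ha : a ∈ B) (hb : b ∈ B)
    (hc : c ∈ B) (h : a + b + c = 0) : a = b ∧ a = c := by
  have key : ∀ x y : W, x + x + y = 0 → x = y := fun x y hxy => by
    have := three_nsmul_eq_zero' x
    rw [← this] at hxy
    exact (add_left_cancel hxy).symm
  by_cases hab : a = b
  · subst hab
    exact ⟨rfl, key a c h⟩
  by_cases hac : a = c
  · subst hac
    exact ⟨key a b (by rw [← h]; abel), rfl⟩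
  by_cases hbc : b = c
  · subst hbc
    have := key b a (by rw [← h]; abel)
    exact ⟨this.symm, this.symm⟩
  exact absurd h (hB a ha b hb c hc hab hac hbc)

theorem mem_level {j : ZMod 3} {x : W} : x ∈ level B ψ j ↔ x ∈ B ∧ ψ x = j := mem_filter

theorem level_subset (j : ZMod 3) : level B ψ j ⊆ B := filter_subset _ _

theorem card_level (j : ZMod 3) : #(level B ψ j) = levelCard B ψ j := rfl

theorem sum_zmod_three {M : Type*} [AddCommMonoid M] (f : ZMod 3 → M) :
    ∑ i, f i = f 0 + f 1 + f 2 :=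
  Fin.sum_univ_three f

theorem sum_levelCard (B : Finset W) (ψ : Module.Dual (ZMod 3) W) :
    levelCard B ψ 0 + levelCard B ψ 1 + levelCard B ψ 2 = #B := by
  rw [← sum_zmod_three (levelCard B ψ)]
  exact (card_eq_sum_card_fiberwise (fun x _ => mem_univ (ψ x))).symm

theorem mem_adj : φ ∈ adj U ψ ↔ ∃ r : ZMod 3, φ - r • ψ ∈ U := by
  rw [adj, Submodule.mem_sup]
  constructor
  · rintro ⟨y, hy, z, hz, rfl⟩
    obtain ⟨r, rfl⟩ := Submodule.mem_span_singleton.1 hz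
    exact ⟨r, by simpa using hy⟩
  · rintro ⟨r, hr⟩
    exact ⟨_, hr, r • ψ, Submodule.mem_span_singleton.2 ⟨r, rfl⟩, by simp⟩

theorem le_adj : U ≤ adj U ψ := le_sup_left

theorem self_mem_adj : ψ ∈ adj U ψ :=
  Submodule.mem_sup_right (Submodule.mem_span_singleton_self ψ)

theorem zmod_three_mul_self {r : ZMod 3} (hr : r ≠ 0) : r * r = 1 := by
  revert r; decide

theorem notMem_of_notMem_adj (h : φ ∉ adj U ψ) : φ ∉ U := fun h' => h (le_adj h')

theorem sub_smul_notMem (h : φ ∉ adj U ψ) (s : ZMod 3) : φ - s • ψ ∉ U :=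
  fun h' => h (mem_adj.2 ⟨s, h'⟩)

theorem notMem_adj_sub_smul (hψ : ψ ∉ U) (h : φ ∉ adj U ψ) (s : ZMod 3) :
    ψ ∉ adj U (φ - s • ψ) := by
  intro h'
  obtain ⟨r, hr⟩ := mem_adj.1 h'
  by_cases h0 : r = 0
  · subst h0
    exact hψ (by simpa using hr)
  · apply h
    refine mem_adj.2 ⟨s + r, ?_⟩
    have := U.smul_mem (-r) hr
    convert this using 1
    rw [smul_sub, smul_smul, neg_mul, zmod_three_mul_self h0]
    module

theorem Flat.mono (hB : Flat U B) (h : C ⊆ B) : Flat U C :=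
  fun u hu x hx y hy => hB u hu x (h hx) y (h hy)

theorem Flat.level (hB : Flat U B) (ψ : Module.Dual (ZMod 3) W) (j : ZMod 3) :
    Flat (adj U ψ) (level B ψ j) := by
  intro u hu x hx y hy
  obtain ⟨r, hr⟩ := mem_adj.1 hu
  have hx' := mem_level.1 hx
  have hy' := mem_level.1 hy
  simpa [hx'.2, hy'.2] using hB _ hr x hx'.1 y hy'.1

theorem CapFree.level (hB : CapFree B) (ψ : Module.Dual (ZMod 3) W) (j : ZMod 3) :
    CapFree (level B ψ j) := hB.mono (level_subset j)

theorem card_adj (hψ : ψ ∉ U) : Nat.card (adj U ψ) = 3 * Nat.card U := by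
  have e : U × ZMod 3 ≃ adj U ψ := by
    refine Equiv.ofBijective
      (fun p => ⟨p.1 + p.2 • ψ, mem_adj.2 ⟨p.2, by simp⟩⟩) ⟨?_, ?_⟩
    · rintro ⟨u, r⟩ ⟨v, s⟩ h
      have h' : (u : Module.Dual (ZMod 3) W) + r • ψ = v + s • ψ := congrArg Subtype.val h
      have hrs : r = s := by
        by_contra hne
        have hd : (s - r) • ψ ∈ U := by
          have : (s - r) • ψ = (u : Module.Dual (ZMod 3) W) - v := by
            refine (sub_smul s r ψ).trans ?_
            rw [sub_eq_sub_iff_add_eq_add, add_comm, ← h']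
          rw [this]
          exact U.sub_mem u.2 v.2
        have := U.smul_mem (s - r) hd
        rw [smul_smul, zmod_three_mul_self (sub_ne_zero.2 (Ne.symm hne)), one_smul] at this
        exact hψ this
      subst hrs
      simpa using h'
    · rintro ⟨φ, hφ⟩
      obtain ⟨r, hr⟩ := mem_adj.1 hφ
      exact ⟨(⟨_, hr⟩, r), by simp⟩
  rw [← Nat.card_congr e, Nat.card_prod, Nat.card_zmod, mul_comm]

variable [Fintype (Module.Dual (ZMod 3) W)]

open scoped Classical in
/-- The functionals outside `U`. -/
noncomputable def outside (U : Submodule (ZMod 3) (Module.Dual (ZMod 3) W)) :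
    Finset (Module.Dual (ZMod 3) W) := {ψ | ψ ∉ U}

theorem mem_outside : ψ ∈ outside U ↔ ψ ∉ U := by simp [outside]

theorem card_outside_add (U : Submodule (ZMod 3) (Module.Dual (ZMod 3) W)) :
    #(outside U) + Nat.card U = Nat.card (Module.Dual (ZMod 3) W) := by
  classical
  rw [Nat.card_eq_fintype_card, Nat.card_eq_fintype_card, Fintype.card_subtype, add_comm,
    outside, card_filter_add_card_filter_not, card_univ]

theorem three_mul_card_apply_eq_zero {v : W} (hv : v ≠ 0) :
    3 * #{ψ : Module.Dual (ZMod 3) W | ψ v = 0} = Nat.card (Module.Dual (ZMod 3) W) := by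
  obtain ⟨ψ₀, hψ₀⟩ : ∃ ψ₀ : Module.Dual (ZMod 3) W, ψ₀ v ≠ 0 := by
    by_contra! h
    exact hv ((Module.forall_dual_apply_eq_zero_iff (ZMod 3) v).1 h)
  have key : ∀ j : ZMod 3, #{ψ : Module.Dual (ZMod 3) W | ψ v = j} =
      #{ψ : Module.Dual (ZMod 3) W | ψ v = 0} := by
    intro j
    refine card_bij' (fun ψ _ => ψ - (j * ψ₀ v) • ψ₀) (fun ψ _ => ψ + (j * ψ₀ v) • ψ₀)
      ?_ ?_ ?_ ?_ <;> simp +contextual [mul_assoc, zmod_three_mul_self hψ₀]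
  have := card_eq_sum_card_fiberwise
    (fun (ψ : Module.Dual (ZMod 3) W) (_ : ψ ∈ univ) => mem_univ (ψ v))
  rw [Nat.card_eq_fintype_card, ← card_univ, this, sum_congr rfl fun j _ => key j]
  simp

theorem card_outside {q : ℕ}
    (hD : Nat.card (Module.Dual (ZMod 3) W) = 3 * (q + 1) * Nat.card U) :
    #(outside U) = Nat.card U * (3 * q + 2) := by
  have := card_outside_add U
  rw [hD] at this
  nlinarith

theorem card_outside_apply_eq_zero {q : ℕ}
    (hD : Nat.card (Module.Dual (ZMod 3) W) = 3 * (q + 1) * Nat.card U) {v : W} (hv : v ≠ 0)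
    (hU : ∀ u ∈ U, u v = 0) : #{ψ ∈ outside U | ψ v = 0} = Nat.card U * q := by
  classical
  have h1 := three_mul_card_apply_eq_zero hv
  have h2 : #{ψ ∈ outside U | ψ v = 0} + Nat.card U =
      #{ψ : Module.Dual (ZMod 3) W | ψ v = 0} := by
    have hc : Nat.card U = #{ψ : Module.Dual (ZMod 3) W | ψ ∈ U} := by
      rw [Nat.card_eq_fintype_card, Fintype.card_subtype]
    rw [hc, ← card_union_of_disjoint]
    · congr 1
      ext ψ
      have := hU ψ
      simp only [mem_union, mem_filter, mem_outside, mem_univ, true_and]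
      tauto
    · rw [disjoint_left]
      intro ψ h3 h4
      simp only [mem_filter, mem_outside, mem_univ, true_and] at h3 h4
      exact h3.1 h4
  rw [hD] at h1
  nlinarith

theorem sum_card_apply_eq_zero {ι : Type*} {q : ℕ}
    (hD : Nat.card (Module.Dual (ZMod 3) W) = 3 * (q + 1) * Nat.card U) (P : Finset ι)
    (f : ι → W) (hU : ∀ u ∈ U, ∀ p ∈ P, u (f p) = 0) [DecidableEq W] :
    ∑ ψ ∈ outside U, #{p ∈ P | ψ (f p) = 0} =
      Nat.card U * (q * #P + 2 * (q + 1) * #{p ∈ P | f p = 0}) := by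
  simp_rw [card_filter]
  rw [sum_comm]
  have : ∀ p ∈ P, (∑ ψ ∈ outside U, if ψ (f p) = 0 then 1 else 0) =
      Nat.card U * q + Nat.card U * (2 * (q + 1) * if f p = 0 then 1 else 0) := by
    intro p hp
    rw [← card_filter]
    split_ifs with h
    · simp only [h, map_zero, filter_true]
      rw [card_outside hD]
      ring
    · rw [card_outside_apply_eq_zero hD h fun u hu => hU u hu p hp]
      simp
  rw [sum_congr rfl this, sum_add_distrib, sum_const]
  simp only [smul_eq_mul, ← mul_sum]
  ring

end Flats

section Profiles

variable {W : Type*} [AddCommGroup W] [Module (ZMod 3) W]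

/-- The triple of level sizes of a functional on `B`. -/
def profile (B : Finset W) (ψ : Module.Dual (ZMod 3) W) : ℕ × ℕ × ℕ :=
  (levelCard B ψ 0, levelCard B ψ 1, levelCard B ψ 2)

/-- The sum of the squares of the entries of a triple. -/
def sqSum (r : ℕ × ℕ × ℕ) : ℕ := r.1 * r.1 + r.2.1 * r.2.1 + r.2.2 * r.2.2

/-- The sum of `rᵢ * sⱼ * tₖ` over the nine index triples with `i + j + k = 0` modulo three. -/
def zeroSum (r s t : ℕ × ℕ × ℕ) : ℕ :=
  r.1 * (s.1 * t.1 + s.2.1 * t.2.2 + s.2.2 * t.2.1) +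
  r.2.1 * (s.2.1 * t.2.1 + s.1 * t.2.2 + s.2.2 * t.1) +
  r.2.2 * (s.2.2 * t.2.2 + s.1 * t.2.1 + s.2.1 * t.1)

theorem sqSum_profile (B : Finset W) (ψ : Module.Dual (ZMod 3) W) :
    sqSum (profile B ψ) = #{p ∈ B ×ˢ B | ψ (p.1 - p.2) = 0} := by
  rw [card_eq_sum_card_fiberwise (t := univ) (f := fun p => ψ p.1) (fun x _ => mem_univ _),
    sum_zmod_three]
  have : ∀ j : ZMod 3, #{p ∈ {p ∈ B ×ˢ B | ψ (p.1 - p.2) = 0} | ψ p.1 = j} =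
      levelCard B ψ j * levelCard B ψ j := by
    intro j
    rw [levelCard, ← card_product]
    congr 1
    ext ⟨x, y⟩
    simp only [mem_filter, mem_product, map_sub, sub_eq_zero]
    constructor
    · rintro ⟨⟨⟨hx, hy⟩, h⟩, rfl⟩
      exact ⟨⟨hx, rfl⟩, hy, h.symm⟩
    · rintro ⟨⟨hx, rfl⟩, hy, h⟩
      exact ⟨⟨⟨hx, hy⟩, h.symm⟩, rfl⟩
  simp only [this]
  rfl

theorem zeroSum_profile (B C E : Finset W) (ψ : Module.Dual (ZMod 3) W) :
    zeroSum (profile B ψ) (profile C ψ) (profile E ψ) =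
      #{p ∈ B ×ˢ C ×ˢ E | ψ (p.1 + p.2.1 + p.2.2) = 0} := by
  rw [card_eq_sum_card_fiberwise (t := univ) (f := fun p => (ψ p.1, ψ p.2.1))
    (fun x _ => mem_univ _), ← univ_product_univ, sum_product]
  have : ∀ i j : ZMod 3, #{p ∈ {p ∈ B ×ˢ C ×ˢ E | ψ (p.1 + p.2.1 + p.2.2) = 0} |
      (ψ p.1, ψ p.2.1) = (i, j)} =
      levelCard B ψ i * (levelCard C ψ j * levelCard E ψ (-i - j)) := by
    intro i j
    rw [levelCard, levelCard, levelCard, ← card_product, ← card_product]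
    congr 1
    ext ⟨x, y, z⟩
    simp only [mem_filter, mem_product, map_add, Prod.mk.injEq]
    constructor
    · rintro ⟨⟨⟨hx, hy, hz⟩, h⟩, rfl, rfl⟩
      exact ⟨⟨hx, rfl⟩, ⟨hy, rfl⟩, hz, by linear_combination h⟩
    · rintro ⟨⟨hx, rfl⟩, ⟨hy, rfl⟩, hz, h⟩
      exact ⟨⟨⟨hx, hy, hz⟩, by linear_combination h⟩, rfl, rfl⟩
  simp only [this, sum_zmod_three, zeroSum, profile, show (-0 - 0 : ZMod 3) = 0 by rfl,
    show (-0 - 1 : ZMod 3) = 2 by rfl, show (-0 - 2 : ZMod 3) = 1 by rfl,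
    show (-1 - 0 : ZMod 3) = 2 by rfl, show (-1 - 1 : ZMod 3) = 1 by rfl,
    show (-1 - 2 : ZMod 3) = 0 by rfl, show (-2 - 0 : ZMod 3) = 1 by rfl,
    show (-2 - 1 : ZMod 3) = 0 by rfl, show (-2 - 2 : ZMod 3) = 2 by rfl]
  ring

variable {U : Submodule (ZMod 3) (Module.Dual (ZMod 3) W)} {B C E : Finset W}
  [Fintype (Module.Dual (ZMod 3) W)] {q : ℕ}

theorem sum_sqSum (hD : Nat.card (Module.Dual (ZMod 3) W) = 3 * (q + 1) * Nat.card U)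
    (hB : Flat U B) : ∑ ψ ∈ outside U, sqSum (profile B ψ) =
      Nat.card U * (q * (#B * #B) + 2 * (q + 1) * #B) := by
  classical
  simp_rw [sqSum_profile]
  rw [sum_card_apply_eq_zero hD (B ×ˢ B) (fun p => p.1 - p.2), card_product]
  · congr 3
    refine card_bij' (fun p _ => p.1) (fun x _ => (x, x)) ?_ ?_ ?_ ?_
    · simp +contextual [sub_eq_zero]
    · simp +contextual
    · simp +contextual [sub_eq_zero]
    · simp
  · intro u hu p hp
    rw [mem_product] at hp
    rw [map_sub, hB u hu _ hp.1 _ hp.2, sub_self]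

theorem sum_zeroSum [DecidableEq W]
    (hD : Nat.card (Module.Dual (ZMod 3) W) = 3 * (q + 1) * Nat.card U)
    (hBCE : ∀ u ∈ U, ∀ x ∈ B, ∀ y ∈ C, ∀ z ∈ E, u (x + y + z) = 0) :
    ∑ ψ ∈ outside U, zeroSum (profile B ψ) (profile C ψ) (profile E ψ) =
      Nat.card U * (q * (#B * #C * #E) +
        2 * (q + 1) * #{p ∈ B ×ˢ C ×ˢ E | p.1 + p.2.1 + p.2.2 = 0}) := by
  simp_rw [zeroSum_profile]
  rw [sum_card_apply_eq_zero hD (B ×ˢ C ×ˢ E) (fun p => p.1 + p.2.1 + p.2.2), card_product,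
    card_product, mul_assoc #B]
  intro u hu p hp
  rw [mem_product, mem_product] at hp
  exact hBCE u hu _ hp.1 _ hp.2.1 _ hp.2.2

theorem sum_zeroSum_self
    (hD : Nat.card (Module.Dual (ZMod 3) W) = 3 * (q + 1) * Nat.card U)
    (hB : CapFree B) (hU : Flat U B) :
    ∑ ψ ∈ outside U, zeroSum (profile B ψ) (profile B ψ) (profile B ψ) =
      Nat.card U * (q * (#B * #B * #B) + 2 * (q + 1) * #B) := by
  classical
  rw [sum_zeroSum hD]
  · congr 3
    refine card_bij' (fun p _ => p.1) (fun x _ => (x, x, x)) ?_ ?_ ?_ ?_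
    · simp +contextual
    · simp +contextual [three_nsmul_eq_zero']
    · rintro ⟨x, y, z⟩ h
      simp only [mem_filter, mem_product] at h
      obtain ⟨h1, h2⟩ := hB.eq_of_add_eq_zero h.1.1 h.1.2.1 h.1.2.2 h.2
      subst h1 h2
      rfl
    · simp
  · intro u hu x hx y hy z hz
    rw [map_add, map_add, hU u hu y hy x hx, hU u hu z hz x hx, ← map_add, ← map_add,
      three_nsmul_eq_zero', map_zero]

end Profiles

/-- A Boolean predicate on triples that does not depend on the order of the entries. -/
def Symmetric3 (ok : ℕ → ℕ → ℕ → Bool) : Prop :=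
  ∀ a b c, ok a b c = ok b a c ∧ ok a b c = ok a c b

set_option synthInstance.maxSize 1000 in
theorem eq_permutation_of_ne : ∀ i j k : ZMod 3, i ≠ j → i ≠ k → j ≠ k →
    (i = 0 ∧ j = 1 ∧ k = 2) ∨ (i = 0 ∧ j = 2 ∧ k = 1) ∨ (i = 1 ∧ j = 0 ∧ k = 2) ∨
      (i = 1 ∧ j = 2 ∧ k = 0) ∨ (i = 2 ∧ j = 0 ∧ k = 1) ∨ (i = 2 ∧ j = 1 ∧ k = 0) := by
  decide

theorem Symmetric3.apply_eq {ok : ℕ → ℕ → ℕ → Bool} (hok : Symmetric3 ok) (f : ZMod 3 → ℕ)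
    {i j k : ZMod 3} (hij : i ≠ j) (hik : i ≠ k) (hjk : j ≠ k) :
    ok (f i) (f j) (f k) = ok (f 0) (f 1) (f 2) := by
  have h1 : ∀ a b c, ok b a c = ok a b c := fun a b c => (hok a b c).1.symm
  have h2 : ∀ a b c, ok a c b = ok a b c := fun a b c => (hok a b c).2.symm
  rcases eq_permutation_of_ne i j k hij hik hjk with
    ⟨rfl, rfl, rfl⟩ | ⟨rfl, rfl, rfl⟩ | ⟨rfl, rfl, rfl⟩ | ⟨rfl, rfl, rfl⟩ |
    ⟨rfl, rfl, rfl⟩ | ⟨rfl, rfl, rfl⟩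
  · rfl
  · exact h2 _ _ _
  · exact h1 _ _ _
  · rw [h2, h1]
  · rw [h1, h2]
  · rw [h1, h2, h1]

theorem exists_sorted (f : ZMod 3 → ℕ) :
    ∃ i j k : ZMod 3, i ≠ j ∧ i ≠ k ∧ j ≠ k ∧ f j ≤ f i ∧ f k ≤ f j := by
  rcases le_total (f 0) (f 1) with h01 | h01 <;> rcases le_total (f 0) (f 2) with h02 | h02 <;>
    rcases le_total (f 1) (f 2) with h12 | h12
  · exact ⟨2, 1, 0, by decide, by decide, by decide, h12, h01⟩
  · exact ⟨1, 2, 0, by decide, by decide, by decide, h12, h02⟩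
  · exact ⟨1, 0, 2, by decide, by decide, by decide, h01, h02⟩
  · exact ⟨1, 0, 2, by decide, by decide, by decide, h01, h02⟩
  · exact ⟨2, 0, 1, by decide, by decide, by decide, h02, h01⟩
  · exact ⟨2, 0, 1, by decide, by decide, by decide, by omega, h01⟩
  · exact ⟨0, 2, 1, by decide, by decide, by decide, h02, h12⟩
  · exact ⟨0, 1, 2, by decide, by decide, by decide, h01, h12⟩

theorem add_add_eq_zero_of_ne : ∀ i j k : ZMod 3, i ≠ j → i ≠ k → j ≠ k → i + j + k = 0 := by
  decide

set_option synthInstance.maxSize 1000 in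
theorem exists_parallel_class : ∀ i j k : ZMod 3, i ≠ j → i ≠ k → j ≠ k → ∀ c : ZMod 3,
    ∃ s t : ZMod 3, ∀ a, t + a + s * i = a ∧ t + a + s * j = a + c ∧
      t + a + s * k = a + 2 * c := by
  decide

/-- The triples with sum `h` and entries at most `M` that satisfy `ok`. -/
def triples (M : ℕ) (ok : ℕ → ℕ → ℕ → Bool) (h : ℕ) : List (ℕ × ℕ × ℕ) :=
  (List.range (M + 1)).flatMap fun a => (List.range (M + 1)).flatMap fun b =>
    bif Nat.ble (a + b) h && Nat.ble (h - a - b) M && ok a b (h - a - b)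
    then [(a, b, h - a - b)] else []

theorem mem_triples {M : ℕ} {ok : ℕ → ℕ → ℕ → Bool} {h a b c : ℕ} (ha : a ≤ M) (hb : b ≤ M)
    (hc : c ≤ M) (habc : a + b + c = h) (hok : ok a b c = true) : (a, b, c) ∈ triples M ok h := by
  have h1 : h - a - b = c := by omega
  simp only [triples, List.mem_flatMap, List.mem_range]
  refine ⟨a, by omega, b, by omega, ?_⟩
  have h2 : Nat.ble (a + b) h = true := Nat.ble_eq_true_of_le (by omega)
  have h3 : Nat.ble c M = true := Nat.ble_eq_true_of_le hc
  rw [h1, h2, h3, hok]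
  simp

/-- The four parallel classes of lines of a three by three grid, other than its rows,
satisfy the line condition `ok` and the condition `okd` on the sums along the lines. -/
def gridOk (ok okd : ℕ → ℕ → ℕ → Bool) : ℕ × ℕ × ℕ → ℕ × ℕ × ℕ → ℕ × ℕ × ℕ → Bool
  | (a₀, a₁, a₂), (b₀, b₁, b₂), (c₀, c₁, c₂) =>
    (ok a₀ b₀ c₀ && (ok a₁ b₁ c₁ && ok a₂ b₂ c₂)) &&
    ((ok a₀ b₁ c₂ && (ok a₁ b₂ c₀ && ok a₂ b₀ c₁)) &&
    ((ok a₀ b₂ c₁ && (ok a₁ b₀ c₂ && ok a₂ b₁ c₀)) &&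
    (okd (a₀ + b₀ + c₀) (a₁ + b₁ + c₁) (a₂ + b₂ + c₂) &&
    (okd (a₀ + b₁ + c₂) (a₁ + b₂ + c₀) (a₂ + b₀ + c₁) &&
    okd (a₀ + b₂ + c₁) (a₁ + b₀ + c₂) (a₂ + b₁ + c₀)))))

/-- Coefficients of a linear combination of `1`, the square sums of the three rows of a grid,
their cubic zero-sums, and the zero-sum of the three rows. -/
structure GridWeights where
  const : ℕ
  sq₀ : ℕ
  sq₁ : ℕ
  sq₂ : ℕ
  cube₀ : ℕ
  cube₁ : ℕ
  cube₂ : ℕ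
  mixed : ℕ

/-- The value of the linear combination on a grid. -/
def GridWeights.eval (w : GridWeights) (r s t : ℕ × ℕ × ℕ) : ℕ :=
  w.const + w.sq₀ * sqSum r + w.sq₁ * sqSum s + w.sq₂ * sqSum t + w.cube₀ * zeroSum r r r +
    w.cube₁ * zeroSum s s s + w.cube₂ * zeroSum t t t + w.mixed * zeroSum r s t

/-- The normalized sum of the linear combination over a pencil, for a cap with row sizes
`x`, `y`, `z`. -/
def GridWeights.total (w : GridWeights) (q x y z : ℕ) : ℕ :=
  w.const * (3 * q + 2) + w.sq₀ * (q * (x * x) + 2 * (q + 1) * x) +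
    w.sq₁ * (q * (y * y) + 2 * (q + 1) * y) + w.sq₂ * (q * (z * z) + 2 * (q + 1) * z) +
    w.cube₀ * (q * (x * x * x) + 2 * (q + 1) * x) +
    w.cube₁ * (q * (y * y * y) + 2 * (q + 1) * y) +
    w.cube₂ * (q * (z * z * z) + 2 * (q + 1) * z) + w.mixed * (q * (x * y * z))

/-- On every admissible grid `w` is at most `w'`, and wherever they agree the column sums
satisfy `good`. -/
def gridCheck (M : ℕ) (ok okd good : ℕ → ℕ → ℕ → Bool) (w w' : GridWeights) (x y z : ℕ) :
    Bool :=
  (triples M ok x).all fun r => (triples M ok y).all fun s => (triples M ok z).all fun t =>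
    !gridOk ok okd r s t ||
      (Nat.ble (w.eval r s t) (w'.eval r s t) &&
        (!Nat.beq (w.eval r s t) (w'.eval r s t) ||
          good (r.1 + s.1 + t.1) (r.2.1 + s.2.1 + t.2.1) (r.2.2 + s.2.2 + t.2.2)))

theorem gridCheck_sound {M : ℕ} {ok okd good : ℕ → ℕ → ℕ → Bool} {w w' : GridWeights}
    {x y z : ℕ} (h : gridCheck M ok okd good w w' x y z = true) {r s t : ℕ × ℕ × ℕ}
    (hr : r ∈ triples M ok x) (hs : s ∈ triples M ok y) (ht : t ∈ triples M ok z)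
    (hg : gridOk ok okd r s t = true) :
    w.eval r s t ≤ w'.eval r s t ∧ (w.eval r s t = w'.eval r s t →
      good (r.1 + s.1 + t.1) (r.2.1 + s.2.1 + t.2.1) (r.2.2 + s.2.2 + t.2.2) = true) := by
  have := List.all_eq_true.1 (List.all_eq_true.1 (List.all_eq_true.1 h r hr) s hs) t ht
  rw [hg] at this
  simp only [Bool.not_true, Bool.false_or, Bool.and_eq_true, Bool.or_eq_true,
    Bool.not_eq_true'] at this
  refine ⟨Nat.le_of_ble_eq_true this.1, fun he => this.2.resolve_left fun hf => ?_⟩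
  rw [he, Nat.beq_refl] at hf
  exact Bool.noConfusion hf

section Grids

variable {W : Type*} [AddCommGroup W] [Module (ZMod 3) W]
  {U : Submodule (ZMod 3) (Module.Dual (ZMod 3) W)} {B : Finset W}
  {φ ψ : Module.Dual (ZMod 3) W}

theorem levelCard_level_sub_smul (B : Finset W) (φ ψ : Module.Dual (ZMod 3) W) (s t i : ZMod 3) :
    levelCard (level B (φ - s • ψ) t) ψ i = levelCard (level B ψ i) φ (t + s * i) := by
  unfold levelCard level
  congr 1
  ext x
  simp only [mem_filter, LinearMap.sub_apply, LinearMap.smul_apply, smul_eq_mul]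
  constructor
  · rintro ⟨⟨hx, h⟩, rfl⟩
    exact ⟨⟨hx, rfl⟩, by linear_combination h⟩
  · rintro ⟨⟨hx, rfl⟩, h⟩
    exact ⟨⟨hx, by linear_combination h⟩, rfl⟩

theorem sum_levelCard_of_ne (B : Finset W) (ψ : Module.Dual (ZMod 3) W) {i j k : ZMod 3}
    (hij : i ≠ j) (hik : i ≠ k) (hjk : j ≠ k) :
    levelCard B ψ i + levelCard B ψ j + levelCard B ψ k = #B := by
  have hu : (univ : Finset (ZMod 3)) = {i, j, k} := by
    revert i j k; decide
  have := card_eq_sum_card_fiberwise (s := B) (fun x _ => mem_univ (ψ x))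
  rw [hu, sum_insert (by simp [hij, hik]), sum_insert (by simp [hjk]), sum_singleton,
    ← add_assoc] at this
  exact this.symm

theorem levelCard_sub_smul (B : Finset W) (φ ψ : Module.Dual (ZMod 3) W) (s t : ZMod 3)
    {i j k : ZMod 3} (hij : i ≠ j) (hik : i ≠ k) (hjk : j ≠ k) :
    levelCard B (φ - s • ψ) t = levelCard (level B ψ i) φ (t + s * i) +
      levelCard (level B ψ j) φ (t + s * j) + levelCard (level B ψ k) φ (t + s * k) := by
  rw [← card_level, ← sum_levelCard_of_ne _ ψ hij hik hjk, levelCard_level_sub_smul,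
    levelCard_level_sub_smul, levelCard_level_sub_smul]

/-- The profiles of the functionals `φ - s • ψ` on the levels of `ψ` form an admissible grid. -/
theorem gridOk_profile {ok okd : ℕ → ℕ → ℕ → Bool} (hok : Symmetric3 ok)
    (hokd : Symmetric3 okd)
    (hline : ∀ χ ∉ U, ∀ t, ∀ φ ∉ adj U χ, ok (levelCard (level B χ t) φ 0)
      (levelCard (level B χ t) φ 1) (levelCard (level B χ t) φ 2) = true)
    (hdir : ∀ χ ∉ U, okd (levelCard B χ 0) (levelCard B χ 1) (levelCard B χ 2) = true)
    (hψ : ψ ∉ U) (hφ : φ ∉ adj U ψ) {i j k : ZMod 3} (hij : i ≠ j) (hik : i ≠ k)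
    (hjk : j ≠ k) :
    gridOk ok okd (profile (level B ψ i) φ) (profile (level B ψ j) φ)
      (profile (level B ψ k) φ) = true := by
  have line : ∀ a b c : ZMod 3, a + b + c = 0 → ok (levelCard (level B ψ i) φ a)
      (levelCard (level B ψ j) φ b) (levelCard (level B ψ k) φ c) = true := by
    intro a b c habc
    obtain ⟨s, t, rfl, rfl, rfl⟩ :
        ∃ s t : ZMod 3, t + s * i = a ∧ t + s * j = b ∧ t + s * k = c := by
      revert i j k a b c; decide
    have := hline _ (sub_smul_notMem hφ s) t ψ (notMem_adj_sub_smul hψ hφ s)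
    rw [← hok.apply_eq _ hij hik hjk] at this
    simpa only [levelCard_level_sub_smul] using this
  have dir : ∀ c : ZMod 3, okd
      (levelCard (level B ψ i) φ 0 + levelCard (level B ψ j) φ (0 + c) +
        levelCard (level B ψ k) φ (0 + 2 * c))
      (levelCard (level B ψ i) φ 1 + levelCard (level B ψ j) φ (1 + c) +
        levelCard (level B ψ k) φ (1 + 2 * c))
      (levelCard (level B ψ i) φ 2 + levelCard (level B ψ j) φ (2 + c) +
        levelCard (level B ψ k) φ (2 + 2 * c)) = true := by
    intro c
    obtain ⟨s, t, h⟩ := exists_parallel_class i j k hij hik hjk c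
    have := hdir _ (sub_smul_notMem hφ s)
    rw [← hokd.apply_eq _ (i := t + 0) (j := t + 1) (k := t + 2)
      (by simp) (by simp; decide) (by simp; decide)] at this
    simpa only [levelCard_sub_smul B φ ψ s _ hij hik hjk, (h _).1, (h _).2.1, (h _).2.2] using this
  have d0 := dir 0
  have d1 := dir 1
  have d2 := dir 2
  simp only [show (0 : ZMod 3) + 0 = 0 by rfl, show (0 : ZMod 3) + 1 = 1 by rfl,
    show (0 : ZMod 3) + 2 = 2 by rfl, show (1 : ZMod 3) + 0 = 1 by rfl,
    show (1 : ZMod 3) + 1 = 2 by rfl, show (1 : ZMod 3) + 2 = 0 by rfl,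
    show (2 : ZMod 3) + 0 = 2 by rfl, show (2 : ZMod 3) + 1 = 0 by rfl,
    show (2 : ZMod 3) + 2 = 1 by rfl, show (2 : ZMod 3) * 0 = 0 by rfl,
    show (2 : ZMod 3) * 1 = 2 by rfl, show (2 : ZMod 3) * 2 = 1 by rfl] at d0 d1 d2
  simp only [profile, gridOk, d0, d1, d2, Bool.and_true, Bool.and_eq_true]
  refine ⟨⟨?_, ?_, ?_⟩, ⟨?_, ?_, ?_⟩, ?_, ?_, ?_⟩ <;> exact line _ _ _ (by decide)

theorem eval_le_of_gridCheck {M x y z : ℕ} {ok okd good : ℕ → ℕ → ℕ → Bool}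
    {w w' : GridWeights} (hok : Symmetric3 ok) (hokd : Symmetric3 okd)
    (hM : ∀ χ ∉ U, ∀ t, ∀ φ ∉ adj U χ, ∀ s, levelCard (level B χ t) φ s ≤ M)
    (hline : ∀ χ ∉ U, ∀ t, ∀ φ ∉ adj U χ, ok (levelCard (level B χ t) φ 0)
      (levelCard (level B χ t) φ 1) (levelCard (level B χ t) φ 2) = true)
    (hdir : ∀ χ ∉ U, okd (levelCard B χ 0) (levelCard B χ 1) (levelCard B χ 2) = true)
    (hψ : ψ ∉ U) {i j k : ZMod 3} (hij : i ≠ j) (hik : i ≠ k) (hjk : j ≠ k)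
    (hx : levelCard B ψ i = x) (hy : levelCard B ψ j = y) (hz : levelCard B ψ k = z)
    (hcheck : gridCheck M ok okd good w w' x y z = true) (hφ : φ ∉ adj U ψ) :
    w.eval (profile (level B ψ i) φ) (profile (level B ψ j) φ) (profile (level B ψ k) φ) ≤
      w'.eval (profile (level B ψ i) φ) (profile (level B ψ j) φ) (profile (level B ψ k) φ) ∧
    (w.eval (profile (level B ψ i) φ) (profile (level B ψ j) φ) (profile (level B ψ k) φ) =
      w'.eval (profile (level B ψ i) φ) (profile (level B ψ j) φ) (profile (level B ψ k) φ) →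
      good (levelCard B φ 0) (levelCard B φ 1) (levelCard B φ 2) = true) := by
  have hrow : ∀ i : ZMod 3, ∀ x, levelCard B ψ i = x →
      profile (level B ψ i) φ ∈ triples M ok x := fun i x hx =>
    mem_triples (hM ψ hψ i φ hφ 0) (hM ψ hψ i φ hφ 1) (hM ψ hψ i φ hφ 2)
      ((sum_levelCard _ φ).trans hx) (hline ψ hψ i φ hφ)
  have hcol : ∀ t, levelCard B φ t = levelCard (level B ψ i) φ t +
      levelCard (level B ψ j) φ t + levelCard (level B ψ k) φ t := fun t => by
    simpa using levelCard_sub_smul B φ ψ 0 t hij hik hjk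
  have := gridCheck_sound hcheck (hrow i x hx) (hrow j y hy) (hrow k z hz)
    (gridOk_profile hok hokd hline hdir hψ hφ hij hik hjk)
  rwa [hcol, hcol, hcol]

variable [Fintype (Module.Dual (ZMod 3) W)] {q : ℕ}

theorem sum_zeroSum_levels
    (hD : Nat.card (Module.Dual (ZMod 3) W) = 3 * (q + 1) * Nat.card (adj U ψ))
    (hB : CapFree B) (hU : Flat U B) {i j k : ZMod 3} (hij : i ≠ j) (hik : i ≠ k)
    (hjk : j ≠ k) :
    ∑ φ ∈ outside (adj U ψ), zeroSum (profile (level B ψ i) φ) (profile (level B ψ j) φ)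
      (profile (level B ψ k) φ) = Nat.card (adj U ψ) *
        (q * (levelCard B ψ i * levelCard B ψ j * levelCard B ψ k)) := by
  classical
  rw [sum_zeroSum hD, filter_eq_empty_iff.2]
  · simp only [card_empty, mul_zero, add_zero]
    rfl
  · rintro ⟨x, y, z⟩ h h0
    simp only [mem_product, mem_level] at h
    have := (hB.eq_of_add_eq_zero h.1.1 h.2.1.1 h.2.2.1 h0).1
    subst this
    exact hij (h.1.2.symm.trans h.2.1.2)
  · intro u hu x hx y hy z hz
    rw [mem_level] at hx hy hz
    obtain ⟨r, hr⟩ := mem_adj.1 hu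
    have h1 := hU _ hr y hy.1 x hx.1
    have h2 := hU _ hr z hz.1 x hx.1
    simp only [LinearMap.sub_apply, LinearMap.smul_apply, smul_eq_mul, hx.2, hy.2, hz.2] at h1 h2
    have h3 := add_add_eq_zero_of_ne i j k hij hik hjk
    rw [map_add, map_add]
    have h4 : (3 : ZMod 3) = 0 := rfl
    linear_combination h1 + h2 + r * h3 + (u x - r * i) * h4

theorem GridWeights.sum_eval (w : GridWeights)
    (hD : Nat.card (Module.Dual (ZMod 3) W) = 3 * (q + 1) * Nat.card (adj U ψ))
    (hB : CapFree B) (hU : Flat U B) {i j k : ZMod 3} (hij : i ≠ j) (hik : i ≠ k)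
    (hjk : j ≠ k) :
    ∑ φ ∈ outside (adj U ψ), w.eval (profile (level B ψ i) φ) (profile (level B ψ j) φ)
      (profile (level B ψ k) φ) = Nat.card (adj U ψ) *
        w.total q (levelCard B ψ i) (levelCard B ψ j) (levelCard B ψ k) := by
  simp only [GridWeights.eval, sum_add_distrib, ← mul_sum, sum_const, card_outside hD,
    sum_sqSum hD (hU.level ψ _), sum_zeroSum_self hD (hB.level ψ _) (hU.level ψ _),
    sum_zeroSum_levels hD hB hU hij hik hjk, card_level, GridWeights.total, smul_eq_mul]
  ring

theorem good_of_gridCheck {M x y z : ℕ} {ok okd good : ℕ → ℕ → ℕ → Bool} (w w' : GridWeights)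
    (hD : Nat.card (Module.Dual (ZMod 3) W) = 3 * (3 * (q + 1)) * Nat.card U)
    (hB : CapFree B) (hU : Flat U B) (hok : Symmetric3 ok) (hokd : Symmetric3 okd)
    (hM : ∀ χ ∉ U, ∀ t, ∀ φ ∉ adj U χ, ∀ s, levelCard (level B χ t) φ s ≤ M)
    (hline : ∀ χ ∉ U, ∀ t, ∀ φ ∉ adj U χ, ok (levelCard (level B χ t) φ 0)
      (levelCard (level B χ t) φ 1) (levelCard (level B χ t) φ 2) = true)
    (hdir : ∀ χ ∉ U, okd (levelCard B χ 0) (levelCard B χ 1) (levelCard B χ 2) = true)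
    (hψ : ψ ∉ U) {i j k : ZMod 3} (hij : i ≠ j) (hik : i ≠ k) (hjk : j ≠ k)
    (hx : levelCard B ψ i = x) (hy : levelCard B ψ j = y) (hz : levelCard B ψ k = z)
    (hcheck : gridCheck M ok okd good w w' x y z = true)
    (htotal : w'.total q x y z ≤ w.total q x y z) (hφ : φ ∉ adj U ψ) :
    good (levelCard B φ 0) (levelCard B φ 1) (levelCard B φ 2) = true := by
  have hD' : Nat.card (Module.Dual (ZMod 3) W) = 3 * (q + 1) * Nat.card (adj U ψ) := by
    rw [hD, card_adj hψ]; ring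
  have hs := fun φ (hφ : φ ∉ adj U ψ) =>
    eval_le_of_gridCheck hok hokd hM hline hdir hψ hij hik hjk hx hy hz hcheck hφ
  have hle := fun φ hφ => (hs φ (mem_outside.1 hφ)).1
  have heq := (sum_eq_sum_iff_of_le hle).1 (le_antisymm (sum_le_sum hle) (by
    rw [w.sum_eval hD' hB hU hij hik hjk, w'.sum_eval hD' hB hU hij hik hjk, hx, hy, hz]
    exact Nat.mul_le_mul_left _ htotal))
  exact (hs φ hφ).2 (heq φ (mem_outside.2 hφ))

theorem not_of_gridCheck {M x y z : ℕ} {ok okd : ℕ → ℕ → ℕ → Bool} (w w' : GridWeights)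
    (hD : Nat.card (Module.Dual (ZMod 3) W) = 3 * (3 * (q + 1)) * Nat.card U)
    (hB : CapFree B) (hU : Flat U B) (hok : Symmetric3 ok) (hokd : Symmetric3 okd)
    (hM : ∀ χ ∉ U, ∀ t, ∀ φ ∉ adj U χ, ∀ s, levelCard (level B χ t) φ s ≤ M)
    (hline : ∀ χ ∉ U, ∀ t, ∀ φ ∉ adj U χ, ok (levelCard (level B χ t) φ 0)
      (levelCard (level B χ t) φ 1) (levelCard (level B χ t) φ 2) = true)
    (hdir : ∀ χ ∉ U, okd (levelCard B χ 0) (levelCard B χ 1) (levelCard B χ 2) = true)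
    (hψ : ψ ∉ U) {i j k : ZMod 3} (hij : i ≠ j) (hik : i ≠ k) (hjk : j ≠ k)
    (hcheck : gridCheck M ok okd (fun _ _ _ => true) w w' x y z = true)
    (htotal : w'.total q x y z < w.total q x y z) :
    ¬(levelCard B ψ i = x ∧ levelCard B ψ j = y ∧ levelCard B ψ k = z) := by
  rintro ⟨hx, hy, hz⟩
  have hD' : Nat.card (Module.Dual (ZMod 3) W) = 3 * (q + 1) * Nat.card (adj U ψ) := by
    rw [hD, card_adj hψ]; ring
  have hle := sum_le_sum fun φ hφ => (eval_le_of_gridCheck hok hokd hM hline hdir hψ hij hik hjk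
    hx hy hz hcheck (mem_outside.1 hφ)).1
  rw [w.sum_eval hD' hB hU hij hik hjk, w'.sum_eval hD' hB hU hij hik hjk, hx, hy, hz] at hle
  exact absurd (Nat.le_of_mul_le_mul_left hle Nat.card_pos) (not_le.2 htotal)

end Grids

section Pencils

variable {W : Type*} [AddCommGroup W] [Module (ZMod 3) W] [Fintype (Module.Dual (ZMod 3) W)]
  {U : Submodule (ZMod 3) (Module.Dual (ZMod 3) W)} {B : Finset W}

theorem sum_pencil {q : ℕ} (a α β : ℤ)
    (hD : Nat.card (Module.Dual (ZMod 3) W) = 3 * (q + 1) * Nat.card U)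
    (hB : CapFree B) (hU : Flat U B) :
    ∑ ψ ∈ outside U, (a + α * sqSum (profile B ψ) +
      β * zeroSum (profile B ψ) (profile B ψ) (profile B ψ)) =
      Nat.card U * (a * (3 * q + 2) + α * (q * (#B * #B) + 2 * (q + 1) * #B) +
        β * (q * (#B * #B * #B) + 2 * (q + 1) * #B)) := by
  have h1 := congrArg (Nat.cast : ℕ → ℤ) (sum_sqSum hD hU)
  have h2 := congrArg (Nat.cast : ℕ → ℤ) (sum_zeroSum_self hD hB hU)
  push_cast at h1 h2
  rw [sum_add_distrib, sum_add_distrib, ← mul_sum, ← mul_sum, h1, h2, sum_const,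
    card_outside hD]
  simp only [nsmul_eq_mul]
  push_cast
  ring

theorem not_pencil {q : ℕ} (a α β : ℤ)
    (hD : Nat.card (Module.Dual (ZMod 3) W) = 3 * (q + 1) * Nat.card U)
    (hB : CapFree B) (hU : Flat U B)
    (htotal : a * (3 * q + 2) + α * (q * (#B * #B) + 2 * (q + 1) * #B) +
      β * (q * (#B * #B * #B) + 2 * (q + 1) * #B) < 0) :
    ¬∀ ψ ∉ U, 0 ≤ a + α * sqSum (profile B ψ) +
      β * zeroSum (profile B ψ) (profile B ψ) (profile B ψ) := by
  intro h
  have h1 := sum_nonneg fun ψ hψ => h ψ (mem_outside.1 hψ)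
  rw [sum_pencil a α β hD hB hU] at h1
  have : (0 : ℤ) < Nat.card U := by exact_mod_cast Nat.card_pos
  nlinarith

theorem pencil_eq_zero {q : ℕ} (a α β : ℤ)
    (hD : Nat.card (Module.Dual (ZMod 3) W) = 3 * (q + 1) * Nat.card U)
    (hB : CapFree B) (hU : Flat U B)
    (htotal : a * (3 * q + 2) + α * (q * (#B * #B) + 2 * (q + 1) * #B) +
      β * (q * (#B * #B * #B) + 2 * (q + 1) * #B) = 0)
    (h : ∀ ψ ∉ U, 0 ≤ a + α * sqSum (profile B ψ) +
      β * zeroSum (profile B ψ) (profile B ψ) (profile B ψ))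
    {ψ : Module.Dual (ZMod 3) W} (hψ : ψ ∉ U) :
    a + α * sqSum (profile B ψ) + β * zeroSum (profile B ψ) (profile B ψ) (profile B ψ) = 0 := by
  refine (sum_eq_zero_iff_of_nonneg fun ψ hψ => h ψ (mem_outside.1 hψ)).1 ?_ ψ
    (mem_outside.2 hψ)
  rw [sum_pencil a α β hD hB hU, htotal, mul_zero]

end Pencils

section Bounds

variable {W : Type*} [AddCommGroup W] [Module (ZMod 3) W]
  {U : Submodule (ZMod 3) (Module.Dual (ZMod 3) W)} {B : Finset W}

theorem card_level_le {k M : ℕ}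
    (h : ∀ (U : Submodule (ZMod 3) (Module.Dual (ZMod 3) W)) (B : Finset W), CapFree B →
      Flat U B → Nat.card (Module.Dual (ZMod 3) W) = k * Nat.card U → #B ≤ M)
    (hB : CapFree B) (hU : Flat U B)
    (hD : Nat.card (Module.Dual (ZMod 3) W) = 3 * k * Nat.card U)
    {ψ : Module.Dual (ZMod 3) W} (hψ : ψ ∉ U) (j : ZMod 3) : levelCard B ψ j ≤ M :=
  h _ _ (hB.level ψ j) (hU.level ψ j) (by rw [hD, card_adj hψ]; ring)

variable [Fintype (Module.Dual (ZMod 3) W)]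

theorem card_le_one_of_flat (hU : Flat U B)
    (hD : Nat.card (Module.Dual (ZMod 3) W) = 1 * Nat.card U) : #B ≤ 1 := by
  rw [card_le_one]
  intro x hx y hy
  rw [← sub_eq_zero, ← Module.forall_dual_apply_eq_zero_iff (ZMod 3)]
  intro ψ
  rw [map_sub, sub_eq_zero]
  refine hU ψ ?_ x hx y hy
  by_contra hψ
  have h1 := card_outside_add U
  have h2 : 0 < #(outside U) := card_pos.2 ⟨ψ, mem_outside.2 hψ⟩
  omega

theorem card_le_of_not_pencil {q k M N : ℕ} (a α β : ℤ)
    (h : ∀ (U : Submodule (ZMod 3) (Module.Dual (ZMod 3) W)) (B : Finset W), CapFree B →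
      Flat U B → Nat.card (Module.Dual (ZMod 3) W) = k * Nat.card U → #B ≤ M)
    (hB : CapFree B) (hU : Flat U B) (hk : k = q + 1)
    (hD : Nat.card (Module.Dual (ZMod 3) W) = 3 * k * Nat.card U)
    (htotal : a * (3 * q + 2) + α * (q * ((N + 1) * (N + 1)) + 2 * (q + 1) * (N + 1)) +
      β * (q * ((N + 1) * (N + 1) * (N + 1)) + 2 * (q + 1) * (N + 1)) < 0)
    (hprofile : ∀ x ≤ M, ∀ y ≤ M, ∀ z ≤ M, x + y + z = N + 1 →
      0 ≤ a + α * sqSum (x, y, z) + β * zeroSum (x, y, z) (x, y, z) (x, y, z)) : #B ≤ N := by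
  subst hk
  by_contra! hN
  obtain ⟨C, hC, hcard⟩ := exists_subset_card_eq (Nat.succ_le_of_lt hN)
  refine not_pencil (B := C) a α β hD (hB.mono hC) (hU.mono hC) ?_ fun ψ hψ => ?_
  · rw [hcard]
    exact_mod_cast htotal
  · exact hprofile _ (card_level_le h (hB.mono hC) (hU.mono hC) hD hψ 0)
      _ (card_level_le h (hB.mono hC) (hU.mono hC) hD hψ 1)
      _ (card_level_le h (hB.mono hC) (hU.mono hC) hD hψ 2)
      ((sum_levelCard C ψ).trans hcard)

theorem card_le_two (hB : CapFree B) (hU : Flat U B)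
    (hD : Nat.card (Module.Dual (ZMod 3) W) = 3 * Nat.card U) : #B ≤ 2 :=
  card_le_of_not_pencil (q := 0) (k := 1) (M := 1) (-9) 0 1
    (fun _ _ _ => card_le_one_of_flat) hB hU rfl hD (by norm_num) (by decide)

theorem card_le_four (hB : CapFree B) (hU : Flat U B)
    (hD : Nat.card (Module.Dual (ZMod 3) W) = 9 * Nat.card U) : #B ≤ 4 :=
  card_le_of_not_pencil (q := 2) (k := 3) (M := 2) 9 (-1) 0
    (fun _ _ => card_le_two) hB hU rfl hD (by norm_num) (by decide)

theorem card_le_nine (hB : CapFree B) (hU : Flat U B)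
    (hD : Nat.card (Module.Dual (ZMod 3) W) = 27 * Nat.card U) : #B ≤ 9 :=
  card_le_of_not_pencil (q := 8) (k := 9) (M := 4) 36 (-1) 0
    (fun _ _ => card_le_four) hB hU rfl hD (by norm_num) (by decide)

/-- The profiles of caps with at most nine points in three-dimensional space, where the only
profiles with sum nine are those of type `(4, 4, 1)` and `(3, 3, 3)`. -/
def okNine (a b c : ℕ) : Bool :=
  Nat.ble (a + b + c) 8 ||
    Nat.beq (a + b + c) 9 && (Nat.beq (a * b * c) 16 || Nat.beq (a * b * c) 27)

theorem symmetric3_okNine : Symmetric3 okNine := fun a b c => by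
  simp only [okNine, add_comm, add_left_comm, mul_comm, mul_left_comm, and_self]

theorem okNine_profile (hB : CapFree B) (hU : Flat U B)
    (hD : Nat.card (Module.Dual (ZMod 3) W) = 27 * Nat.card U)
    {ψ : Module.Dual (ZMod 3) W} (hψ : ψ ∉ U) :
    okNine (levelCard B ψ 0) (levelCard B ψ 1) (levelCard B ψ 2) = true := by
  have hsum := fun ψ => sum_levelCard B ψ
  have hle := card_le_nine hB hU hD
  rcases hle.lt_or_eq with hlt | heq
  · rw [okNine, hsum, Nat.ble_eq_true_of_le (Nat.le_of_lt_succ hlt), Bool.true_or]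
  have hlevel := fun ψ (hψ : ψ ∉ U) => card_level_le (fun _ _ => card_le_four) hB hU hD hψ
  have key : ∀ x ≤ 4, ∀ y ≤ 4, ∀ z ≤ 4, x + y + z = 9 →
      (0 : ℤ) ≤ -324 + 3 * sqSum (x, y, z) + 1 * zeroSum (x, y, z) (x, y, z) (x, y, z) ∧
      ((-324 : ℤ) + 3 * sqSum (x, y, z) + 1 * zeroSum (x, y, z) (x, y, z) (x, y, z) = 0 →
        okNine x y z = true) := by decide
  have hkey := fun ψ hψ => key _ (hlevel ψ hψ 0) _ (hlevel ψ hψ 1) _ (hlevel ψ hψ 2)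
    ((hsum ψ).trans heq)
  refine (hkey ψ hψ).2 (pencil_eq_zero (-324) 3 1 (q := 8) hD hB hU ?_
    (fun ψ hψ => (hkey ψ hψ).1) hψ)
  rw [heq]
  norm_num

end Bounds

/-- The product of the three entries does not occur in the list `l`. -/
def avoids (l : List ℕ) (a b c : ℕ) : Bool := l.all fun n => !Nat.beq (a * b * c) n

theorem symmetric3_avoids (l : List ℕ) : Symmetric3 (avoids l) := fun a b c => by
  simp only [avoids, mul_comm, mul_left_comm, and_self]

/-- The profiles of caps with at most twenty points in four-dimensional space, where those
with 19 or 20 points only have the profiles of types `(9, 9, 2)`, `(8, 6, 6)`, `(9, 9, 1)`,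
`(9, 8, 2)`, `(8, 6, 5)`, and `(7, 6, 6)`. -/
def okTwenty (a b c : ℕ) : Bool :=
  Nat.ble (a + b + c) 18 ||
    (Nat.beq (a + b + c) 20 && (Nat.beq (a * b * c) 162 || Nat.beq (a * b * c) 288)) ||
    (Nat.beq (a + b + c) 19 && (Nat.beq (a * b * c) 81 || Nat.beq (a * b * c) 144 ||
      Nat.beq (a * b * c) 240 || Nat.beq (a * b * c) 252))

theorem symmetric3_okTwenty : Symmetric3 okTwenty := fun a b c => by
  simp only [okTwenty, add_comm, add_left_comm, mul_comm, mul_left_comm, and_self]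

section FourDimensional

variable {W : Type*} [AddCommGroup W] [Module (ZMod 3) W] [Fintype (Module.Dual (ZMod 3) W)]
  {U : Submodule (ZMod 3) (Module.Dual (ZMod 3) W)} {B : Finset W}

theorem levelCard_level_le_four (hB : CapFree B) (hU : Flat U B)
    (hD : Nat.card (Module.Dual (ZMod 3) W) = 81 * Nat.card U) :
    ∀ χ ∉ U, ∀ t, ∀ φ ∉ adj U χ, ∀ s, levelCard (level B χ t) φ s ≤ 4 :=
  fun χ hχ t _ hφ s => card_level_le (k := 9) (fun _ _ => card_le_four) (hB.level χ t)
    (hU.level χ t) (by rw [hD, card_adj hχ]; ring) hφ s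

theorem okNine_levelCard_level (hB : CapFree B) (hU : Flat U B)
    (hD : Nat.card (Module.Dual (ZMod 3) W) = 81 * Nat.card U) :
    ∀ χ ∉ U, ∀ t, ∀ φ ∉ adj U χ, okNine (levelCard (level B χ t) φ 0)
      (levelCard (level B χ t) φ 1) (levelCard (level B χ t) φ 2) = true :=
  fun χ hχ t _ hφ => okNine_profile (hB.level χ t) (hU.level χ t)
    (by rw [hD, card_adj hχ]; ring) hφ

theorem not_levelCard_of_gridCheck (l : List ℕ) (x y z : ℕ) (w w' : GridWeights)
    (hB : CapFree B) (hU : Flat U B)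
    (hD : Nat.card (Module.Dual (ZMod 3) W) = 81 * Nat.card U)
    (hdir : ∀ χ ∉ U, avoids l (levelCard B χ 0) (levelCard B χ 1) (levelCard B χ 2) = true)
    (hcheck : gridCheck 4 okNine (avoids l) (fun _ _ _ => true) w w' x y z = true)
    (htotal : w'.total 8 x y z < w.total 8 x y z) :
    ∀ χ ∉ U, ∀ i j k : ZMod 3, i ≠ j → i ≠ k → j ≠ k →
      ¬(levelCard B χ i = x ∧ levelCard B χ j = y ∧ levelCard B χ k = z) :=
  fun _ hχ _ _ _ hij hik hjk => not_of_gridCheck w w' (q := 8) hD hB hU symmetric3_okNine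
    (symmetric3_avoids l) (levelCard_level_le_four hB hU hD) (okNine_levelCard_level hB hU hD)
    hdir hχ hij hik hjk hcheck htotal

theorem exists_notMem (hD : Nat.card (Module.Dual (ZMod 3) W) = 81 * Nat.card U) :
    ∃ ψ, ψ ∉ U := by
  by_contra! h
  have h1 := card_outside (q := 26) hD
  have h2 : outside U = ∅ := eq_empty_of_forall_notMem fun ψ hψ => mem_outside.1 hψ (h ψ)
  rw [h2, card_empty] at h1
  have : 0 < Nat.card U := Nat.card_pos
  omega

set_option synthInstance.maxSize 1000 in
theorem card_le_twenty (hB : CapFree B) (hU : Flat U B)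
    (hD : Nat.card (Module.Dual (ZMod 3) W) = 81 * Nat.card U) : #B ≤ 20 := by
  by_contra! hN
  obtain ⟨C, hC, hcard⟩ := exists_subset_card_eq (Nat.succ_le_of_lt hN)
  obtain ⟨ψ, hψ⟩ := exists_notMem hD
  have exclude := fun x y z w w' => not_levelCard_of_gridCheck [] x y z w w' (hB.mono hC)
    (hU.mono hC) hD (fun _ _ => rfl)
  have h1 := exclude 9 9 3 ⟨72, 0, 0, 1, 0, 0, 0, 0⟩ ⟨0, 0, 0, 0, 0, 0, 0, 1⟩
    (by decide +kernel) (by decide) ψ hψ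
  have h2 := exclude 9 8 4 ⟨86, 0, 0, 1, 0, 0, 0, 0⟩ ⟨0, 0, 0, 0, 0, 0, 0, 1⟩
    (by decide +kernel) (by decide) ψ hψ
  have h3 := exclude 9 7 5 ⟨73, 0, 1, 1, 0, 0, 0, 0⟩ ⟨0, 0, 0, 0, 0, 0, 0, 1⟩
    (by decide +kernel) (by decide) ψ hψ
  have h4 := exclude 9 6 6 ⟨124, 2, 0, 4, 0, 0, 1, 0⟩ ⟨0, 0, 5, 0, 0, 2, 0, 1⟩
    (by decide +kernel) (by decide) ψ hψ
  have h5 := exclude 8 8 5 ⟨118, 2, 2, 0, 0, 0, 0, 0⟩ ⟨0, 0, 0, 1, 1, 0, 1, 0⟩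
    (by decide +kernel) (by decide) ψ hψ
  have h6 := exclude 8 7 6 ⟨49, 1, 1, 1, 0, 0, 0, 0⟩ ⟨0, 0, 0, 0, 0, 0, 0, 1⟩
    (by decide +kernel) (by decide) ψ hψ
  have h7 := exclude 7 7 7 ⟨52, 1, 1, 1, 0, 0, 0, 0⟩ ⟨0, 0, 0, 0, 1, 0, 0, 0⟩
    (by decide +kernel) (by decide) ψ hψ
  obtain ⟨i, j, k, hij, hik, hjk, hji, hkj⟩ := exists_sorted (levelCard C ψ)
  have hsum := sum_levelCard_of_ne C ψ hij hik hjk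
  have hle := card_level_le (k := 27) (fun _ _ => card_le_nine) (hB.mono hC) (hU.mono hC) hD hψ
  have key : ∀ a ≤ 9, ∀ b ≤ a, ∀ c ≤ b, a + b + c = 21 →
      (a, b, c) ∈ [(9, 9, 3), (9, 8, 4), (9, 7, 5), (9, 6, 6), (8, 8, 5), (8, 7, 6),
        (7, 7, 7)] := by
    decide
  have := key _ (hle i) _ hji _ hkj (hsum.trans hcard)
  simp only [List.mem_cons, List.not_mem_nil, Prod.mk.injEq, or_false] at this
  rcases this with h | h | h | h | h | h | h
  exacts [h1 i j k hij hik hjk h, h2 i j k hij hik hjk h, h3 i j k hij hik hjk h,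
    h4 i j k hij hik hjk h, h5 i j k hij hik hjk h, h6 i j k hij hik hjk h,
    h7 i j k hij hik hjk h]

set_option synthInstance.maxSize 1000 in
theorem okTwenty_of_card_eq_twenty (hB : CapFree B) (hU : Flat U B)
    (hD : Nat.card (Module.Dual (ZMod 3) W) = 81 * Nat.card U) (hcard : #B = 20) :
    ∀ ψ ∉ U, okTwenty (levelCard B ψ 0) (levelCard B ψ 1) (levelCard B ψ 2) = true := by
  intro ψ hψ
  have exclude := fun x y z w w' => not_levelCard_of_gridCheck [] x y z w w' hB hU hD
    (fun _ _ => rfl)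
  have h1 := exclude 9 8 3 ⟨72, 0, 0, 0, 0, 0, 1, 0⟩ ⟨0, 0, 0, 3, 0, 0, 0, 1⟩
    (by decide +kernel) (by decide) ψ hψ
  have h2 := exclude 9 7 4 ⟨64, 0, 0, 2, 0, 0, 0, 0⟩ ⟨0, 0, 0, 0, 0, 0, 0, 1⟩
    (by decide +kernel) (by decide) ψ hψ
  have h3 := exclude 9 6 5 ⟨110, 1, 0, 0, 0, 0, 0, 0⟩ ⟨0, 0, 1, 0, 0, 0, 1, 1⟩
    (by decide +kernel) (by decide) ψ hψ
  have h4 := exclude 8 8 4 ⟨2894, 0, 0, 0, 0, 0, 0, 0⟩ ⟨0, 6, 18, 24, 1, 3, 5, 17⟩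
    (by decide +kernel) (by decide) ψ hψ
  have h5 := exclude 8 7 5 ⟨135, 2, 0, 2, 0, 0, 0, 0⟩ ⟨0, 0, 0, 0, 1, 0, 1, 0⟩
    (by decide +kernel) (by decide) ψ hψ
  have h6 := exclude 7 7 6 ⟨71, 1, 1, 0, 0, 0, 0, 0⟩ ⟨0, 0, 0, 0, 1, 0, 0, 0⟩
    (by decide +kernel) (by decide) ψ hψ
  obtain ⟨i, j, k, hij, hik, hjk, hji, hkj⟩ := exists_sorted (levelCard B ψ)
  have key : ∀ a ≤ 9, ∀ b ≤ a, ∀ c ≤ b, a + b + c = 20 → okTwenty a b c = true ∨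
      (a, b, c) ∈ [(9, 8, 3), (9, 7, 4), (9, 6, 5), (8, 8, 4), (8, 7, 5), (7, 7, 6)] := by
    decide
  have := key _ (card_level_le (k := 27) (fun _ _ => card_le_nine) hB hU hD hψ i) _ hji _ hkj
    ((sum_levelCard_of_ne B ψ hij hik hjk).trans hcard)
  simp only [List.mem_cons, List.not_mem_nil, Prod.mk.injEq, or_false] at this
  rcases this with h | h | h | h | h | h | h
  · rwa [← symmetric3_okTwenty.apply_eq _ hij hik hjk]
  exacts [(h1 i j k hij hik hjk h).elim, (h2 i j k hij hik hjk h).elim,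
    (h3 i j k hij hik hjk h).elim, (h4 i j k hij hik hjk h).elim,
    (h5 i j k hij hik hjk h).elim, (h6 i j k hij hik hjk h).elim]

end FourDimensional

section FourDimensional

variable {W : Type*} [AddCommGroup W] [Module (ZMod 3) W]
  {U : Submodule (ZMod 3) (Module.Dual (ZMod 3) W)} {B : Finset W}

theorem exists_levelCard_eq_of_mem_adj {χ ψ : Module.Dual (ZMod 3) W} (hU : Flat U B)
    (hχ : χ ∈ adj U ψ) (hχU : χ ∉ U) : ∃ r : ZMod 3, r ≠ 0 ∧
      ∃ s, ∀ j, levelCard B χ j = levelCard B ψ (r * j + s) := by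
  obtain ⟨r, hr⟩ := mem_adj.1 hχ
  have hr0 : r ≠ 0 := by
    rintro rfl
    exact hχU (by simpa using hr)
  refine ⟨r, hr0, ?_⟩
  rcases B.eq_empty_or_nonempty with rfl | ⟨x₀, hx₀⟩
  · exact ⟨0, fun j => by simp [levelCard]⟩
  refine ⟨-(r * (χ x₀ - r * ψ x₀)), fun j => ?_⟩
  unfold levelCard
  congr 1
  refine filter_congr fun x hx => ?_
  have h := hU _ hr x hx x₀ hx₀
  simp only [LinearMap.sub_apply, LinearMap.smul_apply, smul_eq_mul] at h
  have hrr := zmod_three_mul_self hr0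
  constructor
  · rintro rfl
    linear_combination -r * h - ψ x * hrr
  · intro hx
    linear_combination h + r * hx + (j - (χ x₀ - r * ψ x₀)) * hrr

set_option synthInstance.maxSize 1000 in
theorem Symmetric3.levelCard_of_mem_adj {ok : ℕ → ℕ → ℕ → Bool} (hok : Symmetric3 ok)
    {χ ψ : Module.Dual (ZMod 3) W} (hU : Flat U B) (hχ : χ ∈ adj U ψ) (hχU : χ ∉ U)
    (hψ : ok (levelCard B ψ 0) (levelCard B ψ 1) (levelCard B ψ 2) = true) :
    ok (levelCard B χ 0) (levelCard B χ 1) (levelCard B χ 2) = true := by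
  obtain ⟨r, hr, s, h⟩ := exists_levelCard_eq_of_mem_adj hU hχ hχU
  have this : ∀ r s : ZMod 3, r ≠ 0 → r * 0 + s ≠ r * 1 + s ∧
      r * 0 + s ≠ r * 2 + s ∧ r * 1 + s ≠ r * 2 + s := by decide
  rw [h, h, h, hok.apply_eq _ (this r s hr).1 (this r s hr).2.1 (this r s hr).2.2, hψ]

variable [Fintype (Module.Dual (ZMod 3) W)]

theorem okTwenty_of_levelCard_eq (hB : CapFree B) (hU : Flat U B)
    (hD : Nat.card (Module.Dual (ZMod 3) W) = 81 * Nat.card U)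
    (havoid : ∀ χ ∉ U,
      avoids [189, 216, 225] (levelCard B χ 0) (levelCard B χ 1) (levelCard B χ 2) = true)
    {ψ : Module.Dual (ZMod 3) W} (hψ : ψ ∉ U) {i j k : ZMod 3} (hij : i ≠ j) (hik : i ≠ k)
    (hjk : j ≠ k) (hi : levelCard B ψ i = 9) (hj : levelCard B ψ j = 9)
    (hk : levelCard B ψ k = 1) :
    ∀ χ ∉ U, okTwenty (levelCard B χ 0) (levelCard B χ 1) (levelCard B χ 2) = true := by
  intro χ hχ
  by_cases hadj : χ ∈ adj U ψ
  · refine symmetric3_okTwenty.levelCard_of_mem_adj hU hadj hχ ?_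
    rw [← symmetric3_okTwenty.apply_eq _ hij hik hjk, hi, hj, hk]
    rfl
  · exact good_of_gridCheck (q := 8) (good := okTwenty) ⟨162, 0, 0, 0, 0, 0, 0, 0⟩
      ⟨0, 1, 1, 0, 0, 0, 0, 4⟩ hD hB hU symmetric3_okNine (symmetric3_avoids [189, 216, 225])
      (levelCard_level_le_four hB hU hD) (okNine_levelCard_level hB hU hD) havoid hψ hij hik hjk
      hi hj hk (by decide +kernel) (by decide) hadj

set_option synthInstance.maxSize 1000 in
theorem okTwenty_of_card_eq_nineteen (hB : CapFree B) (hU : Flat U B)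
    (hD : Nat.card (Module.Dual (ZMod 3) W) = 81 * Nat.card U) (hcard : #B = 19) :
    ∀ ψ ∉ U, okTwenty (levelCard B ψ 0) (levelCard B ψ 1) (levelCard B ψ 2) = true := by
  have exclude := fun l x y z w w' => not_levelCard_of_gridCheck l x y z w w' hB hU hD
  have h1 := exclude [] 9 7 3 ⟨61, 2, 0, 0, 1, 0, 1, 0⟩ ⟨0, 0, 3, 4, 0, 1, 0, 3⟩
    (fun _ _ => rfl) (by decide +kernel) (by decide)
  have h2 := exclude [] 9 6 4 ⟨135, 2, 0, 0, 1, 0, 0, 0⟩ ⟨0, 0, 4, 1, 0, 1, 1, 4⟩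
    (fun _ _ => rfl) (by decide +kernel) (by decide)
  have h3 := exclude [] 9 5 5 ⟨243, 3, 1, 0, 0, 0, 0, 0⟩ ⟨0, 0, 0, 1, 0, 2, 1, 3⟩
    (fun _ _ => rfl) (by decide +kernel) (by decide)
  have key : ∀ a ≤ 9, ∀ b ≤ a, ∀ c ≤ b, a + b + c = 19 → (a, b, c) ∈ [(9, 7, 3), (9, 6, 4),
      (9, 5, 5), (9, 9, 1), (8, 7, 4), (8, 8, 3), (7, 7, 5), (9, 8, 2), (8, 6, 5), (7, 6, 6)] := by
    decide
  have sorted : ∀ ok, Symmetric3 ok → ∀ χ ∉ U, (∀ i j k : ZMod 3, i ≠ j → i ≠ k → j ≠ k →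
      (levelCard B χ i, levelCard B χ j, levelCard B χ k) ∈ [(9, 7, 3), (9, 6, 4), (9, 5, 5),
        (9, 9, 1), (8, 7, 4), (8, 8, 3), (7, 7, 5), (9, 8, 2), (8, 6, 5), (7, 6, 6)] →
      ok (levelCard B χ i) (levelCard B χ j) (levelCard B χ k) = true) →
      ok (levelCard B χ 0) (levelCard B χ 1) (levelCard B χ 2) = true := by
    intro ok hok χ hχ h
    obtain ⟨i, j, k, hij, hik, hjk, hji, hkj⟩ := exists_sorted (levelCard B χ)
    rw [← hok.apply_eq _ hij hik hjk]
    exact h i j k hij hik hjk (key _ (card_level_le (k := 27) (fun _ _ => card_le_nine) hB hU hD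
      hχ i) _ hji _ hkj ((sum_levelCard_of_ne B χ hij hik hjk).trans hcard))
  simp only [List.mem_cons, List.not_mem_nil, Prod.mk.injEq, or_false] at sorted
  by_cases hex : ∃ ψ ∉ U, ∃ i j k : ZMod 3, i ≠ j ∧ i ≠ k ∧ j ≠ k ∧ levelCard B ψ i = 9 ∧
      levelCard B ψ j = 9 ∧ levelCard B ψ k = 1
  · obtain ⟨ψ, hψ, i, j, k, hij, hik, hjk, hi, hj, hk⟩ := hex
    refine okTwenty_of_levelCard_eq hB hU hD (fun χ hχ =>
      sorted _ (symmetric3_avoids _) χ hχ fun i j k hij hik hjk h => ?_) hψ hij hik hjk hi hj hk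
    rcases h with h | h | h | ⟨h, h', h''⟩ | ⟨h, h', h''⟩ | ⟨h, h', h''⟩ | ⟨h, h', h''⟩ |
      ⟨h, h', h''⟩ | ⟨h, h', h''⟩ | ⟨h, h', h''⟩
    · exact (h1 χ hχ i j k hij hik hjk h).elim
    · exact (h2 χ hχ i j k hij hik hjk h).elim
    · exact (h3 χ hχ i j k hij hik hjk h).elim
    all_goals rw [h, h', h'']; rfl
  have h4 : ∀ χ ∉ U, ∀ i j k : ZMod 3, i ≠ j → i ≠ k → j ≠ k →
      ¬(levelCard B χ i = 9 ∧ levelCard B χ j = 9 ∧ levelCard B χ k = 1) :=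
    fun χ hχ i j k hij hik hjk h => hex ⟨χ, hχ, i, j, k, hij, hik, hjk, h⟩
  have h5 := exclude [189, 216, 225, 81] 8 7 4 ⟨3191, 0, 0, 0, 0, 0, 0, 0⟩
    ⟨0, 9, 21, 28, 1, 3, 5, 25⟩ (fun χ hχ =>
      sorted _ (symmetric3_avoids _) χ hχ fun i j k hij hik hjk h => by
    rcases h with h | h | h | h | ⟨h, h', h''⟩ | ⟨h, h', h''⟩ | ⟨h, h', h''⟩ |
      ⟨h, h', h''⟩ | ⟨h, h', h''⟩ | ⟨h, h', h''⟩
    · exact (h1 χ hχ i j k hij hik hjk h).elim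
    · exact (h2 χ hχ i j k hij hik hjk h).elim
    · exact (h3 χ hχ i j k hij hik hjk h).elim
    · exact (h4 χ hχ i j k hij hik hjk h).elim
    all_goals rw [h, h', h'']; rfl) (by decide +kernel) (by decide)
  have h6 := exclude [189, 216, 225, 81, 224] 8 8 3 ⟨0, 0, 0, 0, 0, 0, 1, 0⟩
    ⟨9, 0, 0, 0, 0, 0, 0, 0⟩ (fun χ hχ =>
      sorted _ (symmetric3_avoids _) χ hχ fun i j k hij hik hjk h => by
    rcases h with h | h | h | h | h | ⟨h, h', h''⟩ | ⟨h, h', h''⟩ |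
      ⟨h, h', h''⟩ | ⟨h, h', h''⟩ | ⟨h, h', h''⟩
    · exact (h1 χ hχ i j k hij hik hjk h).elim
    · exact (h2 χ hχ i j k hij hik hjk h).elim
    · exact (h3 χ hχ i j k hij hik hjk h).elim
    · exact (h4 χ hχ i j k hij hik hjk h).elim
    · exact (h5 χ hχ i j k hij hik hjk h).elim
    all_goals rw [h, h', h'']; rfl) (by decide +kernel) (by decide)
  have h7 := exclude [189, 216, 225, 81, 224, 192] 7 7 5 ⟨23, 0, 0, 1, 0, 0, 1, 0⟩
    ⟨0, 0, 0, 0, 0, 0, 0, 1⟩ (fun χ hχ =>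
      sorted _ (symmetric3_avoids _) χ hχ fun i j k hij hik hjk h => by
    rcases h with h | h | h | h | h | h | ⟨h, h', h''⟩ |
      ⟨h, h', h''⟩ | ⟨h, h', h''⟩ | ⟨h, h', h''⟩
    · exact (h1 χ hχ i j k hij hik hjk h).elim
    · exact (h2 χ hχ i j k hij hik hjk h).elim
    · exact (h3 χ hχ i j k hij hik hjk h).elim
    · exact (h4 χ hχ i j k hij hik hjk h).elim
    · exact (h5 χ hχ i j k hij hik hjk h).elim
    · exact (h6 χ hχ i j k hij hik hjk h).elim
    all_goals rw [h, h', h'']; rfl) (by decide +kernel) (by decide)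
  intro χ hχ
  refine sorted _ symmetric3_okTwenty χ hχ fun i j k hij hik hjk h => ?_
  rcases h with h | h | h | h | h | h | h | ⟨h, h', h''⟩ | ⟨h, h', h''⟩ | ⟨h, h', h''⟩
  · exact (h1 χ hχ i j k hij hik hjk h).elim
  · exact (h2 χ hχ i j k hij hik hjk h).elim
  · exact (h3 χ hχ i j k hij hik hjk h).elim
  · exact (h4 χ hχ i j k hij hik hjk h).elim
  · exact (h5 χ hχ i j k hij hik hjk h).elim
  · exact (h6 χ hχ i j k hij hik hjk h).elim
  · exact (h7 χ hχ i j k hij hik hjk h).elim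
  all_goals rw [h, h', h'']; rfl

theorem okTwenty_profile (hB : CapFree B) (hU : Flat U B)
    (hD : Nat.card (Module.Dual (ZMod 3) W) = 81 * Nat.card U)
    {ψ : Module.Dual (ZMod 3) W} (hψ : ψ ∉ U) :
    okTwenty (levelCard B ψ 0) (levelCard B ψ 1) (levelCard B ψ 2) = true := by
  have hle := card_le_twenty hB hU hD
  rcases Nat.lt_or_ge #B 19 with hlt | hge
  · rw [okTwenty, sum_levelCard, Nat.ble_eq_true_of_le (Nat.le_of_lt_succ hlt), Bool.true_or,
      Bool.true_or]
  · obtain h | h : #B = 19 ∨ #B = 20 := by omega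
    exacts [okTwenty_of_card_eq_nineteen hB hU hD h ψ hψ,
      okTwenty_of_card_eq_twenty hB hU hD h ψ hψ]

end FourDimensional

section FiveDimensional

variable {W : Type*} [AddCommGroup W] [Module (ZMod 3) W] [Fintype (Module.Dual (ZMod 3) W)]
  {U : Submodule (ZMod 3) (Module.Dual (ZMod 3) W)} {B : Finset W}

theorem not_levelCard_of_gridCheck_okTwenty (l : List ℕ) (x y z : ℕ) (w w' : GridWeights)
    (hB : CapFree B) (hU : Flat U B)
    (hD : Nat.card (Module.Dual (ZMod 3) W) = 243 * Nat.card U)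
    (hdir : ∀ χ ∉ U, avoids l (levelCard B χ 0) (levelCard B χ 1) (levelCard B χ 2) = true)
    (hcheck : gridCheck 9 okTwenty (avoids l) (fun _ _ _ => true) w w' x y z = true)
    (htotal : w'.total 26 x y z < w.total 26 x y z) :
    ∀ χ ∉ U, ∀ i j k : ZMod 3, i ≠ j → i ≠ k → j ≠ k →
      ¬(levelCard B χ i = x ∧ levelCard B χ j = y ∧ levelCard B χ k = z) :=
  fun _ hχ _ _ _ hij hik hjk => not_of_gridCheck w w' (q := 26) hD hB hU symmetric3_okTwenty
    (symmetric3_avoids l)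
    (fun χ hχ t _ hφ s => card_level_le (k := 27) (fun _ _ => card_le_nine) (hB.level χ t)
      (hU.level χ t) (by rw [hD, card_adj hχ]; ring) hφ s)
    (fun χ hχ t _ hφ => okTwenty_profile (hB.level χ t) (hU.level χ t)
      (by rw [hD, card_adj hχ]; ring) hφ)
    hdir hχ hij hik hjk hcheck htotal

theorem eq_or_eq_or_eq_of_ne : ∀ i j k : ZMod 3, i ≠ j → i ≠ k → j ≠ k →
    ∀ l, l = i ∨ l = j ∨ l = k := by
  decide

set_option synthInstance.maxSize 100000 in
/-- A 45-cap in five-dimensional space meets parallel hyperplanes in `15, 15, 15` or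
`18, 18, 9` points. -/
theorem levelCard_of_card_eq_fortyFive (hB : CapFree B) (hU : Flat U B)
    (hD : Nat.card (Module.Dual (ZMod 3) W) = 243 * Nat.card U) (hcard : #B = 45) :
    ∀ ψ ∉ U, (∀ j, levelCard B ψ j = 15) ∨
      ∃ i, levelCard B ψ i = 9 ∧ ∀ j ≠ i, levelCard B ψ j = 18 := by
  have exclude := fun l x y z w w' => not_levelCard_of_gridCheck_okTwenty l x y z w w' hB hU hD
  have h1 := exclude [] 20 20 5 ⟨374, 1, 1, 0, 1, 1, 1, 0⟩ ⟨0, 0, 0, 7, 0, 0, 0, 9⟩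
    (fun _ _ => rfl) (by decide +kernel) (by decide)
  have h2 := exclude [] 20 19 6 ⟨1847, 2, 4, 0, 1, 1, 1, 0⟩ ⟨0, 0, 0, 10, 0, 0, 0, 10⟩
    (fun _ _ => rfl) (by decide +kernel) (by decide)
  have h3 := exclude [] 20 18 7 ⟨6583, 15, 0, 0, 3, 0, 0, 0⟩ ⟨0, 0, 21, 11, 0, 2, 2, 12⟩
    (fun _ _ => rfl) (by decide +kernel) (by decide)
  have h4 := exclude [] 19 19 7 ⟨19760, 0, 0, 0, 1, 0, 0, 0⟩ ⟨0, 5, 26, 16, 0, 2, 0, 16⟩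
    (fun _ _ => rfl) (by decide +kernel) (by decide)
  have key1 : ∀ a ≤ 20, ∀ b ≤ a, ∀ c ≤ b, a + b + c = 45 →
      (a, b, c) ∈ [(20, 20, 5), (20, 19, 6), (20, 18, 7), (19, 19, 7)] ∨
        avoids [2000, 2280, 2520, 2527] a b c = true := by decide +kernel
  have key2 : ∀ a ≤ 20, ∀ b ≤ a, ∀ c ≤ b, a + b + c = 45 →
      (a, b, c) ∈ [(20, 20, 5), (20, 19, 6), (20, 18, 7), (19, 19, 7), (19, 18, 8)] ∨
        Nat.ble 36450 (9 * sqSum (a, b, c) + zeroSum (a, b, c) (a, b, c) (a, b, c)) = true ∧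
        (Nat.beq 36450 (9 * sqSum (a, b, c) + zeroSum (a, b, c) (a, b, c) (a, b, c)) = false ∨
          (a, b, c) ∈ [(15, 15, 15), (18, 18, 9)]) := by decide +kernel
  have hlevel := fun ψ (hψ : ψ ∉ U) =>
    card_level_le (k := 81) (fun _ _ => card_le_twenty) hB hU hD hψ
  have sorted : ∀ ok, Symmetric3 ok → ∀ χ ∉ U, (∀ i j k : ZMod 3, i ≠ j → i ≠ k → j ≠ k →
      ((levelCard B χ i, levelCard B χ j, levelCard B χ k) ∈
        [(20, 20, 5), (20, 19, 6), (20, 18, 7), (19, 19, 7)] ∨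
        avoids [2000, 2280, 2520, 2527] (levelCard B χ i) (levelCard B χ j) (levelCard B χ k) =
          true) →
      ok (levelCard B χ i) (levelCard B χ j) (levelCard B χ k) = true) →
      ok (levelCard B χ 0) (levelCard B χ 1) (levelCard B χ 2) = true := by
    intro ok hok χ hχ h
    obtain ⟨i, j, k, hij, hik, hjk, hji, hkj⟩ := exists_sorted (levelCard B χ)
    rw [← hok.apply_eq _ hij hik hjk]
    exact h i j k hij hik hjk (key1 _ (hlevel χ hχ i) _ hji _ hkj
      ((sum_levelCard_of_ne B χ hij hik hjk).trans hcard))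
  simp only [List.mem_cons, List.not_mem_nil, Prod.mk.injEq, or_false] at sorted
  have h5 := exclude [2000, 2280, 2520, 2527] 19 18 8 ⟨42328, 0, 0, 0, 1, 0, 0, 0⟩
    ⟨0, 1, 57, 48, 0, 6, 6, 27⟩ (fun χ hχ =>
      sorted _ (symmetric3_avoids _) χ hχ fun i j k hij hik hjk h => by
    rcases h with (h | h | h | h) | h
    · exact (h1 χ hχ i j k hij hik hjk h).elim
    · exact (h2 χ hχ i j k hij hik hjk h).elim
    · exact (h3 χ hχ i j k hij hik hjk h).elim
    · exact (h4 χ hχ i j k hij hik hjk h).elim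
    · exact h) (by decide +kernel) (by decide)
  have hperm : ∀ ψ, ∀ i j k : ZMod 3, i ≠ j → i ≠ k → j ≠ k →
      (-36450 : ℤ) + 9 * sqSum (profile B ψ) + 1 * zeroSum (profile B ψ) (profile B ψ)
        (profile B ψ) = -36450 + 9 * sqSum (levelCard B ψ i, levelCard B ψ j, levelCard B ψ k) +
        1 * zeroSum (levelCard B ψ i, levelCard B ψ j, levelCard B ψ k)
          (levelCard B ψ i, levelCard B ψ j, levelCard B ψ k)
          (levelCard B ψ i, levelCard B ψ j, levelCard B ψ k) := by
    intro ψ i j k hij hik hjk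
    rcases eq_permutation_of_ne i j k hij hik hjk with ⟨rfl, rfl, rfl⟩ | ⟨rfl, rfl, rfl⟩ |
      ⟨rfl, rfl, rfl⟩ | ⟨rfl, rfl, rfl⟩ | ⟨rfl, rfl, rfl⟩ | ⟨rfl, rfl, rfl⟩
    · rfl
    all_goals
      simp only [profile, sqSum, zeroSum]
      push_cast
      ring
  have hsorted : ∀ ψ ∉ U, ∃ i j k : ZMod 3, i ≠ j ∧ i ≠ k ∧ j ≠ k ∧
      Nat.ble 36450 (9 * sqSum (levelCard B ψ i, levelCard B ψ j, levelCard B ψ k) +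
        zeroSum (levelCard B ψ i, levelCard B ψ j, levelCard B ψ k)
          (levelCard B ψ i, levelCard B ψ j, levelCard B ψ k)
          (levelCard B ψ i, levelCard B ψ j, levelCard B ψ k)) = true ∧
      (Nat.beq 36450 (9 * sqSum (levelCard B ψ i, levelCard B ψ j, levelCard B ψ k) +
        zeroSum (levelCard B ψ i, levelCard B ψ j, levelCard B ψ k)
          (levelCard B ψ i, levelCard B ψ j, levelCard B ψ k)
          (levelCard B ψ i, levelCard B ψ j, levelCard B ψ k)) = false ∨
        (levelCard B ψ i, levelCard B ψ j, levelCard B ψ k) ∈ [(15, 15, 15), (18, 18, 9)]) := by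
    intro ψ hψ
    obtain ⟨i, j, k, hij, hik, hjk, hji, hkj⟩ := exists_sorted (levelCard B ψ)
    refine ⟨i, j, k, hij, hik, hjk, ?_⟩
    refine (key2 _ (hlevel ψ hψ i) _ hji _ hkj
      ((sum_levelCard_of_ne B ψ hij hik hjk).trans hcard)).resolve_left fun h => ?_
    simp only [List.mem_cons, List.not_mem_nil, Prod.mk.injEq, or_false] at h
    rcases h with h | h | h | h | h
    exacts [h1 ψ hψ i j k hij hik hjk h, h2 ψ hψ i j k hij hik hjk h,
      h3 ψ hψ i j k hij hik hjk h, h4 ψ hψ i j k hij hik hjk h, h5 ψ hψ i j k hij hik hjk h]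
  intro ψ hψ
  have hzero := pencil_eq_zero (-36450) 9 1 (q := 80) hD hB hU (by rw [hcard]; norm_num)
    (fun ψ hψ => by
      obtain ⟨i, j, k, hij, hik, hjk, h, -⟩ := hsorted ψ hψ
      rw [hperm ψ i j k hij hik hjk]
      have := Nat.le_of_ble_eq_true h
      omega) hψ
  obtain ⟨i, j, k, hij, hik, hjk, -, h⟩ := hsorted ψ hψ
  rw [hperm ψ i j k hij hik hjk] at hzero
  have hmem := h.resolve_left fun h => by
    have := Nat.ne_of_beq_eq_false h
    omega
  simp only [List.mem_cons, List.not_mem_nil, Prod.mk.injEq, or_false] at hmem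
  have hall := eq_or_eq_or_eq_of_ne i j k hij hik hjk
  rcases hmem with ⟨hi, hj, hk⟩ | ⟨hi, hj, hk⟩
  · left
    intro j'
    rcases hall j' with rfl | rfl | rfl <;> assumption
  · right
    refine ⟨k, hk, fun j' hj' => ?_⟩
    rcases hall j' with rfl | rfl | rfl
    exacts [hi, hj, absurd rfl hj']

end FiveDimensional

section ThinPlanes

variable {W : Type*} [AddCommGroup W] [Module (ZMod 3) W]
  {U : Submodule (ZMod 3) (Module.Dual (ZMod 3) W)} {B : Finset W}
  {α β γ ψ : Module.Dual (ZMod 3) W}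

/-- The number of hyperplanes parallel to the kernel of `ψ` that meet `B` in nine points. -/
def thinCount (B : Finset W) (ψ : Module.Dual (ZMod 3) W) : ℕ :=
  #{j | levelCard B ψ j = 9}

/-- Among two coordinates modulo three, their difference and their sum, either all four vanish or
exactly one does. -/
theorem card_four_directions {ι : Type*} (s : Finset ι) (a b : ι → ZMod 3) :
    #{x ∈ s | a x = 0} + #{x ∈ s | b x = 0} + #{x ∈ s | a x - b x = 0} +
      #{x ∈ s | a x + b x = 0} = #s + 3 * #{x ∈ s | a x = 0 ∧ b x = 0} := by
  have key : ∀ a b : ZMod 3, (if a = 0 then 1 else 0) + (if b = 0 then 1 else 0) +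
      (if a - b = 0 then 1 else 0) + (if a + b = 0 then 1 else 0) =
      1 + 3 * if a = 0 ∧ b = 0 then 1 else 0 := by
    decide
  simp only [card_filter, card_eq_sum_ones s, mul_sum, ← sum_add_distrib]
  exact sum_congr rfl fun x _ => key _ _

theorem levelCard_add_levelCard (B : Finset W) (α β : Module.Dual (ZMod 3) W) (i j : ZMod 3) :
    levelCard B α i + levelCard B β j + levelCard B (α - β) (i - j) +
      levelCard B (α + β) (i + j) = #B + 3 * levelCard (level B α i) β j := by
  have h := card_four_directions B (fun x => α x - i) (fun x => β x - j)
  have hsub : ∀ x, α x - i - (β x - j) = (α - β) x - (i - j) := fun x => by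
    rw [LinearMap.sub_apply]; ring
  have hadd : ∀ x, α x - i + (β x - j) = (α + β) x - (i + j) := fun x => by
    rw [LinearMap.add_apply]; ring
  simp only [hsub, hadd, sub_eq_zero] at h
  simpa only [levelCard, level, filter_filter] using h

theorem levelCard_level_comm (B : Finset W) (α β : Module.Dual (ZMod 3) W) (i j : ZMod 3) :
    levelCard (level B α i) β j = levelCard (level B β j) α i :=
  congrArg card (filter_comm _ _ _)

theorem levelCard_neg (B : Finset W) (ψ : Module.Dual (ZMod 3) W) (j : ZMod 3) :
    levelCard B (-ψ) j = levelCard B ψ (-j) := by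
  simp only [levelCard, LinearMap.neg_apply, neg_eq_iff_eq_neg]

theorem thinCount_neg (B : Finset W) (ψ : Module.Dual (ZMod 3) W) :
    thinCount B (-ψ) = thinCount B ψ := by
  simp only [thinCount, levelCard_neg]
  exact card_equiv (Equiv.neg _) (by simp)

theorem thinCount_zero (hcard : #B = 45) : thinCount B 0 = 0 := by
  rw [thinCount, card_eq_zero, filter_eq_empty_iff]
  intro j _
  by_cases h : (0 : ZMod 3) = j <;> simp [levelCard, h, hcard]

variable [Fintype (Module.Dual (ZMod 3) W)]

theorem levelCard_and_thinCount (hB : CapFree B)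
    (hD : Nat.card (Module.Dual (ZMod 3) W) = 243) (hcard : #B = 45) (hψ : ψ ≠ 0) (j : ZMod 3) :
    levelCard B ψ j = 15 ∧ thinCount B ψ = 0 ∨
      (levelCard B ψ j = 9 ∨ levelCard B ψ j = 18) ∧ thinCount B ψ = 1 := by
  have hU : Flat (⊥ : Submodule (ZMod 3) (Module.Dual (ZMod 3) W)) B := fun u hu x _ y _ => by
    rw [(Submodule.mem_bot _).1 hu]; rfl
  rcases levelCard_of_card_eq_fortyFive hB hU (by simpa using hD) hcard ψ (by simpa using hψ)
    with h | ⟨i, hi, h⟩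
  · simp [h, thinCount]
  · right
    constructor
    · by_cases hji : j = i
      · exact Or.inl (hji ▸ hi)
      · exact Or.inr (h j hji)
    · rw [thinCount, card_eq_one]
      refine ⟨i, ?_⟩
      ext k
      by_cases hk : k = i
      · simp [hk, hi]
      · simp [hk, h k hk]

theorem sqSum_profile_eq (hB : CapFree B)
    (hD : Nat.card (Module.Dual (ZMod 3) W) = 243) (hcard : #B = 45) (hψ : ψ ≠ 0) :
    sqSum (profile B ψ) = 675 + 54 * thinCount B ψ := by
  have hsum := sum_levelCard B ψ
  rw [hcard] at hsum
  have key : ∀ a b c t : ℕ, (a = 15 ∧ t = 0 ∨ (a = 9 ∨ a = 18) ∧ t = 1) →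
      (b = 15 ∧ t = 0 ∨ (b = 9 ∨ b = 18) ∧ t = 1) →
      (c = 15 ∧ t = 0 ∨ (c = 9 ∨ c = 18) ∧ t = 1) → a + b + c = 45 →
      a * a + b * b + c * c = 675 + 54 * t := by
    rintro _ _ _ _ (⟨rfl, rfl⟩ | ⟨rfl | rfl, rfl⟩) (⟨rfl, h⟩ | ⟨rfl | rfl, h⟩)
      (⟨rfl, h'⟩ | ⟨rfl | rfl, h'⟩) hs <;> omega
  exact key _ _ _ _ (levelCard_and_thinCount hB hD hcard hψ 0)
    (levelCard_and_thinCount hB hD hcard hψ 1) (levelCard_and_thinCount hB hD hcard hψ 2) hsum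

theorem sum_thinCount (hB : CapFree B) (hD : Nat.card (Module.Dual (ZMod 3) W) = 243)
    (hcard : #B = 45) : ∑ ψ, thinCount B ψ = 110 := by
  classical
  have hU : Flat (⊥ : Submodule (ZMod 3) (Module.Dual (ZMod 3) W)) B := fun u hu x _ y _ => by
    rw [(Submodule.mem_bot _).1 hu]; rfl
  have hD' : Nat.card (Module.Dual (ZMod 3) W) = 3 * (80 + 1) *
      Nat.card (⊥ : Submodule (ZMod 3) (Module.Dual (ZMod 3) W)) := by simpa using hD
  have h1 := sum_sqSum hD' hU
  have h2 := card_outside hD'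
  rw [sum_congr rfl fun ψ hψ => sqSum_profile_eq hB hD hcard
    (by simpa using mem_outside.1 hψ), sum_add_distrib, ← mul_sum, sum_const, h2, hcard] at h1
  have h3 : ∑ ψ, thinCount B ψ = ∑ ψ ∈ outside ⊥, thinCount B ψ := by
    refine (sum_subset (subset_univ _) fun ψ _ hψ => ?_).symm
    rw [mem_outside, not_not, Submodule.mem_bot] at hψ
    rw [hψ, thinCount_zero hcard]
  simp only [Submodule.mem_bot, Nat.card_unique, smul_eq_mul] at h1
  omega

/-- A nine-cap in three-dimensional space has nine directions of type `(4, 4, 1)`. -/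
theorem sum_sqSum_of_card_eq_nine (hU : Flat U B)
    (hD : Nat.card (Module.Dual (ZMod 3) W) = 27 * Nat.card U) (hcard : #B = 9) :
    ∑ ψ ∈ outside U, sqSum (profile B ψ) = 810 * Nat.card U := by
  rw [sum_sqSum (q := 8) hD hU, hcard]
  ring

set_option synthInstance.maxSize 100000 in
theorem levelCard_mod_three_of_card_eq_nine (hB : CapFree B) (hU : Flat U B)
    (hD : Nat.card (Module.Dual (ZMod 3) W) = 27 * Nat.card U) (hcard : #B = 9) (hψ : ψ ∉ U) :
    levelCard B ψ 0 % 3 = 0 ∧ sqSum (profile B ψ) = 27 ∨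
      levelCard B ψ 0 % 3 = 1 ∧ sqSum (profile B ψ) = 33 := by
  have key : ∀ a ≤ 9, ∀ b ≤ 9, ∀ c ≤ 9, a + b + c = 9 → okNine a b c = true →
      a % 3 = 0 ∧ sqSum (a, b, c) = 27 ∨ a % 3 = 1 ∧ sqSum (a, b, c) = 33 := by
    decide +kernel
  have hsum := sum_levelCard B ψ
  exact key _ (by omega) _ (by omega) _ (by omega) (hsum.trans hcard) (okNine_profile hB hU hD hψ)

theorem sum_outside_add (hγ : γ ∈ U) (f : Module.Dual (ZMod 3) W → ℕ) :
    ∑ ψ ∈ outside U, f (ψ + γ) = ∑ ψ ∈ outside U, f ψ := by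
  refine sum_equiv (Equiv.addRight γ) (fun ψ => ?_) fun ψ _ => rfl
  simp [mem_outside, Submodule.add_mem_iff_left _ hγ]

/-- If a hyperplane meets a 45-cap in 18 points and contains nine points of the cap on one
of its parallels, then its slices by any other such functional are nonempty. -/
theorem levelCard_level_ne_zero (hB : CapFree B)
    (hD : Nat.card (Module.Dual (ZMod 3) W) = 243) (hcard : #B = 45)
    (hγ : thinCount B γ = 1) (hβ : thinCount B β = 1) (hind : β ∉ adj ⊥ γ) {g : ZMod 3}
    (hg : levelCard B γ g = 18) (b : ZMod 3) : levelCard (level B γ g) β b ≠ 0 := by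
  classical
  intro hb
  have hγ0 : γ ∉ (⊥ : Submodule (ZMod 3) (Module.Dual (ZMod 3) W)) := by
    rw [Submodule.mem_bot]
    rintro rfl
    rw [thinCount_zero hcard] at hγ
    omega
  have hU : Flat (⊥ : Submodule (ZMod 3) (Module.Dual (ZMod 3) W)) B := fun u hu x _ y _ => by
    rw [(Submodule.mem_bot _).1 hu]; rfl
  have hU1 := hU.level γ g
  have hB1 := hB.level γ g
  obtain ⟨c, d, hbc, hbd, hcd⟩ : ∃ c d : ZMod 3, b ≠ c ∧ b ≠ d ∧ c ≠ d := by
    clear hb; revert b; decide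
  have hcard2 : Nat.card (adj (adj ⊥ γ) β) = 9 := by
    rw [card_adj hind, card_adj hγ0]; simp
  have hD2 : Nat.card (Module.Dual (ZMod 3) W) = 27 * Nat.card (adj (adj ⊥ γ) β) := by
    rw [hD, hcard2]
  have hle : ∀ j, #(level (level B γ g) β j) ≤ 9 := fun j =>
    card_le_nine (hB1.level β j) (hU1.level β j) hD2
  have hsum := sum_levelCard_of_ne (level B γ g) β hbc hbd hcd
  rw [card_level, hg, hb] at hsum
  have hc : #(level (level B γ g) β c) = 9 := by
    have h1 := hle c; have h2 := hle d
    simp only [card_level] at *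
    omega
  have hd : #(level (level B γ g) β d) = 9 := by
    have h1 := hle c; have h2 := hle d
    simp only [card_level] at *
    omega
  have hpoint : ∀ ψ ∈ outside (adj (adj ⊥ γ) β),
      sqSum (profile (level (level B γ g) β c) ψ) + sqSum (profile (level (level B γ g) β d) ψ) ≤
        54 + 6 * (thinCount B ψ + thinCount B (ψ + -γ) + thinCount B (ψ + γ)) := by
    intro ψ hψ
    rw [mem_outside] at hψ
    have h1 : ψ ∉ adj ⊥ γ := notMem_of_notMem_adj hψ
    have hne : ∀ s : ZMod 3, ψ - s • γ ≠ 0 := fun s h =>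
      sub_smul_notMem h1 s ((Submodule.mem_bot _).2 h)
    have hadd : ψ + γ ≠ 0 := fun h => h1 <| by
      rw [eq_neg_of_add_eq_zero_left h]
      exact Submodule.neg_mem _ self_mem_adj
    have h4 := levelCard_add_levelCard B ψ γ 0 g
    rw [levelCard_level_comm, hg, hcard] at h4
    have h5 := levelCard_sub_smul (level B γ g) ψ β 0 0 hbc hbd hcd
    have h6 : levelCard (level (level B γ g) β b) ψ 0 = 0 := by
      rw [card_eq_zero.1 (show #(level (level B γ g) β b) = 0 from hb)]; rfl
    simp only [zero_smul, sub_zero, zero_mul, add_zero, h6, zero_add] at h5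
    rw [h5] at h4
    have e0 := levelCard_and_thinCount hB hD hcard (by simpa using hne 0) (ψ := ψ) 0
    have e1 := levelCard_and_thinCount hB hD hcard (by simpa using hne 1) (ψ := ψ - γ) (0 - g)
    have e2 := levelCard_and_thinCount hB hD hcard
      hadd (0 + g)
    have k1 := levelCard_mod_three_of_card_eq_nine (hB1.level β c) (hU1.level β c) hD2 hc hψ
    have k2 := levelCard_mod_three_of_card_eq_nine (hB1.level β d) (hU1.level β d) hD2 hd hψ
    rw [← sub_eq_add_neg]
    omega
  have htotal := sum_le_sum hpoint
  have hγU : γ ∈ adj (adj ⊥ γ) β := le_adj self_mem_adj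
  rw [sum_add_distrib, sum_sqSum_of_card_eq_nine (hU1.level β c) hD2 hc,
    sum_sqSum_of_card_eq_nine (hU1.level β d) hD2 hd, sum_add_distrib, ← mul_sum,
    sum_add_distrib, sum_add_distrib, sum_outside_add hγU,
    sum_outside_add (Submodule.neg_mem _ hγU), sum_const, card_outside (q := 8) hD2, hcard2,
    smul_eq_mul] at htotal
  have hsub : ∑ ψ ∈ outside (adj (adj ⊥ γ) β), thinCount B ψ +
      ∑ ψ ∈ {γ, -γ, β}, thinCount B ψ ≤ ∑ ψ, thinCount B ψ := by
    rw [← sum_union]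
    · exact sum_le_sum_of_subset (subset_univ _)
    · rw [disjoint_right]
      intro ψ hψ hψ'
      rw [mem_outside] at hψ'
      simp only [mem_insert, mem_singleton] at hψ
      rcases hψ with rfl | rfl | rfl
      exacts [hψ' hγU, hψ' (Submodule.neg_mem _ hγU), hψ' self_mem_adj]
  have hγneg : γ ≠ -γ := fun h => hγ0 <| by
    rw [Submodule.mem_bot]
    have := three_nsmul_eq_zero' γ
    rwa [eq_neg_iff_add_eq_zero.1 h, zero_add] at this
  have hγβ : γ ≠ β := fun h => hind (h ▸ self_mem_adj)
  have hγβ' : -γ ≠ β := fun h => hind (h ▸ Submodule.neg_mem _ self_mem_adj)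
  rw [sum_insert (by simp [hγneg, hγβ]), sum_insert (by simp [hγβ']), sum_singleton,
    thinCount_neg, hγ, hβ, sum_thinCount hB hD hcard] at hsub
  omega

end ThinPlanes

section Differences

variable {W : Type*} [AddCommGroup W] {B : Finset W}

/-- The number of ways to write `d` as a difference of two elements of `B`. -/
def repCount [DecidableEq W] (B : Finset W) (d : W) : ℕ := #{x ∈ B | x + d ∈ B}

theorem repCount_eq [DecidableEq W] (B : Finset W) (d : W) :
    repCount B d = #{z ∈ B ×ˢ B | z.1 - z.2 = d} := by
  refine card_nbij' (fun x => (x + d, x)) Prod.snd ?_ ?_ ?_ ?_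
  · intro x hx
    simpa [and_comm] using hx
  · rintro ⟨x, y⟩ hz
    simp only [coe_filter, mem_product, Set.mem_ofPred_eq] at hz ⊢
    rw [← hz.2, add_sub_cancel]
    exact ⟨hz.1.2, hz.1.1⟩
  · intro x _; rfl
  · rintro ⟨x, y⟩ hz
    simp only [coe_filter, mem_product, Set.mem_ofPred_eq] at hz
    simp [← hz.2]

theorem repCount_neg [DecidableEq W] (B : Finset W) (d : W) : repCount B (-d) = repCount B d := by
  rw [repCount_eq, repCount_eq]
  refine card_equiv (Equiv.prodComm _ _) fun z => ?_
  rw [mem_filter, mem_filter, mem_product, mem_product, ← neg_sub, neg_inj, and_comm (a := _ ∈ _)]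
  rfl

theorem sum_repCount [DecidableEq W] [Fintype W] (B : Finset W) :
    ∑ d, repCount B d = #B * #B := by
  simp_rw [repCount_eq]
  rw [← card_product]
  exact (card_eq_sum_card_fiberwise fun x _ => mem_univ _).symm

/-- The elements that are not differences of two elements of `B`. -/
def nonDifferences [DecidableEq W] [Fintype W] (B : Finset W) : Finset W :=
  {d | ∀ x ∈ B, x + d ∉ B}

theorem mem_nonDifferences [DecidableEq W] [Fintype W] {d : W} :
    d ∈ nonDifferences B ↔ ∀ x ∈ B, x + d ∉ B := by
  simp [nonDifferences]

theorem mem_nonDifferences_iff_repCount [DecidableEq W] [Fintype W] {d : W} :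
    d ∈ nonDifferences B ↔ repCount B d = 0 := by
  rw [mem_nonDifferences, repCount, card_eq_zero, filter_eq_empty_iff]

theorem ne_zero_of_mem_nonDifferences [DecidableEq W] [Fintype W] (hcard : #B = 45) {d : W}
    (hd : d ∈ nonDifferences B) : d ≠ 0 := by
  rintro rfl
  obtain ⟨x, hx⟩ := card_pos.1 (by rw [hcard]; norm_num : 0 < #B)
  exact mem_nonDifferences.1 hd x hx (by rwa [add_zero])

variable [Module (ZMod 3) W] [Fintype (Module.Dual (ZMod 3) W)]

open scoped Classical in
/-- The hyperplanes that meet `B` in nine points, as pairs of a functional and its value. -/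
noncomputable def thinPlanes (B : Finset W) : Finset (Module.Dual (ZMod 3) W × ZMod 3) :=
  {p | levelCard B p.1 p.2 = 9}

theorem mem_thinPlanes {p : Module.Dual (ZMod 3) W × ZMod 3} :
    p ∈ thinPlanes B ↔ levelCard B p.1 p.2 = 9 := by
  simp [thinPlanes]

/-- The number of pairs in `thinPlanes B` whose functional vanishes at `v`. -/
noncomputable def thinDirectionCount (B : Finset W) (v : W) : ℕ := #{p ∈ thinPlanes B | p.1 v = 0}

theorem thinDirectionCount_neg (B : Finset W) (v : W) :
    thinDirectionCount B (-v) = thinDirectionCount B v := by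
  simp [thinDirectionCount]

theorem sum_thinCount_filter (B : Finset W) (P : Module.Dual (ZMod 3) W → Prop)
    [DecidablePred P] : ∑ ψ with P ψ, thinCount B ψ = #{p ∈ thinPlanes B | P p.1} := by
  rw [thinPlanes, filter_filter, card_filter, ← univ_product_univ, sum_product, sum_filter]
  refine sum_congr rfl fun ψ _ => ?_
  by_cases h : P ψ
  · simp only [h, thinCount, card_filter, and_true, if_true]
  · simp only [h, and_false, if_false, sum_const_zero]

theorem card_thinPlanes (hB : CapFree B) (hD : Nat.card (Module.Dual (ZMod 3) W) = 243)
    (hcard : #B = 45) : #(thinPlanes B) = 110 := by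
  have := sum_thinCount_filter B fun _ => True
  simpa [sum_thinCount hB hD hcard] using this.symm

theorem card_apply_eq_zero [DecidableEq W] (hD : Nat.card (Module.Dual (ZMod 3) W) = 243) (v : W) :
    #{ψ : Module.Dual (ZMod 3) W | ψ v = 0} = 81 + 162 * if v = 0 then 1 else 0 := by
  by_cases h : v = 0
  · simpa [h, Nat.card_eq_fintype_card] using hD
  · have := three_mul_card_apply_eq_zero h
    simp only [h, if_false]
    omega

theorem card_apply_eq_zero_and [DecidableEq W] (hD : Nat.card (Module.Dual (ZMod 3) W) = 243)
    {v : W} (hv : v ≠ 0) (w : W) :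
    #{ψ : Module.Dual (ZMod 3) W | ψ v = 0 ∧ ψ w = 0} =
      27 + 54 * ((if w = 0 then 1 else 0) + (if w = v then 1 else 0) +
        if w = -v then 1 else 0) := by
  have h := card_four_directions (univ : Finset (Module.Dual (ZMod 3) W)) (fun ψ => ψ v)
    (fun ψ => ψ w)
  simp only [← map_sub, ← map_add, card_apply_eq_zero hD, hv, card_univ,
    ← Nat.card_eq_fintype_card, hD, sub_eq_zero, add_eq_zero_iff_neg_eq, if_false,
    eq_comm (b := w)] at h
  omega

theorem thinDirectionCount_eq [DecidableEq W] (hB : CapFree B)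
    (hD : Nat.card (Module.Dual (ZMod 3) W) = 243) (hcard : #B = 45) {v : W} (hv : v ≠ 0) :
    thinDirectionCount B v = 20 + 2 * repCount B v := by
  classical
  have h1 : ∑ ψ : Module.Dual (ZMod 3) W with ψ v = 0, sqSum (profile B ψ) =
      ∑ z ∈ B ×ˢ B, #{ψ : Module.Dual (ZMod 3) W | ψ v = 0 ∧ ψ (z.1 - z.2) = 0} := by
    simp_rw [sqSum_profile, ← filter_filter]
    exact sum_card_bipartiteAbove_eq_sum_card_bipartiteBelow
      (fun (ψ : Module.Dual (ZMod 3) W) (z : W × W) => ψ (z.1 - z.2) = 0)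
  have h2 : ∀ d, ∑ z ∈ B ×ˢ B, (if z.1 - z.2 = d then 1 else 0) = repCount B d := fun d => by
    rw [repCount_eq, card_filter]
  have h3 : repCount B 0 = 45 := by simp [repCount, hcard]
  simp_rw [card_apply_eq_zero_and hD hv] at h1
  rw [sum_add_distrib, ← mul_sum, sum_add_distrib, sum_add_distrib, h2, h2, h2, repCount_neg, h3,
    sum_const, card_product, hcard, smul_eq_mul] at h1
  have h4 : ∀ ψ : Module.Dual (ZMod 3) W, sqSum (profile B ψ) =
      675 + 54 * thinCount B ψ + if ψ = 0 then 1350 else 0 := fun ψ => by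
    by_cases hψ : ψ = 0
    · subst hψ
      rw [sqSum_profile, thinCount_zero hcard]
      simp [hcard]
    · simp [sqSum_profile_eq hB hD hcard hψ, hψ]
  simp_rw [h4] at h1
  rw [sum_add_distrib, sum_add_distrib, ← mul_sum, sum_thinCount_filter, sum_const,
    card_apply_eq_zero hD, sum_ite_eq' , if_neg hv, if_pos (by simp), smul_eq_mul] at h1
  unfold thinDirectionCount
  omega

theorem card_thinPlanes_through [DecidableEq W] (hB : CapFree B)
    (hD : Nat.card (Module.Dual (ZMod 3) W) = 243) (hcard : #B = 45) {x : W} (hx : x ∈ B) :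
    #{p ∈ thinPlanes B | p.1 x = p.2} = 22 := by
  classical
  have h1 : ∑ ψ : Module.Dual (ZMod 3) W, levelCard B ψ (ψ x) =
      ∑ y ∈ B, #{ψ : Module.Dual (ZMod 3) W | ψ (y - x) = 0} := by
    simp_rw [map_sub, sub_eq_zero]
    exact sum_card_bipartiteAbove_eq_sum_card_bipartiteBelow
      (fun (ψ : Module.Dual (ZMod 3) W) y => ψ y = ψ x)
  simp_rw [card_apply_eq_zero hD, sub_eq_zero] at h1
  rw [sum_add_distrib, ← mul_sum, sum_ite_eq', if_pos hx, sum_const, hcard] at h1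
  have h2 : ∀ ψ : Module.Dual (ZMod 3) W,
      levelCard B ψ (ψ x) + 9 * (if levelCard B ψ (ψ x) = 9 then 1 else 0) =
      15 + 3 * thinCount B ψ + if ψ = 0 then 30 else 0 := fun ψ => by
    by_cases hψ : ψ = 0
    · subst hψ
      rw [thinCount_zero hcard]
      simp [levelCard, hcard]
    · rw [if_neg hψ]
      rcases levelCard_and_thinCount hB hD hcard hψ (ψ x) with ⟨h, h'⟩ | ⟨h | h, h'⟩ <;>
        simp [h, h']
  have h3 := sum_congr (rfl : (univ : Finset (Module.Dual (ZMod 3) W)) = _) fun ψ _ => h2 ψ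
  rw [sum_add_distrib, sum_add_distrib, sum_add_distrib, ← mul_sum, ← mul_sum,
    sum_thinCount hB hD hcard, sum_ite_eq', if_pos (mem_univ _), h1, sum_const, card_univ,
    ← Nat.card_eq_fintype_card, hD, ← card_filter] at h3
  have h4 : #{p ∈ thinPlanes B | p.1 x = p.2} =
      #{ψ : Module.Dual (ZMod 3) W | levelCard B ψ (ψ x) = 9} := by
    refine card_nbij' Prod.fst (fun ψ => (ψ, ψ x)) ?_ ?_ ?_ ?_
    · rintro ⟨ψ, j⟩ h
      simp only [coe_filter, mem_thinPlanes, Set.mem_ofPred_eq, mem_univ, true_and] at h ⊢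
      rw [h.2, h.1]
    · intro ψ h
      simpa [mem_thinPlanes] using h
    · rintro ⟨ψ, j⟩ h
      simp only [coe_filter, Set.mem_ofPred_eq] at h
      rw [← h.2]
    · intro ψ _; rfl
  simp only [smul_eq_mul] at h3
  omega

end Differences

section ReflectionComplement

variable {W : Type*} [AddCommGroup W] [Module (ZMod 3) W] {B : Finset W}

theorem dual_neg_one_smul (f : Module.Dual (ZMod 3) W) : (-1 : ZMod 3) • f = -f := by
  ext x
  simp

variable [Fintype (Module.Dual (ZMod 3) W)] {p q : Module.Dual (ZMod 3) W × ZMod 3}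

theorem ne_zero_of_mem_thinPlanes (hcard : #B = 45) (hp : p ∈ thinPlanes B) : p.1 ≠ 0 := by
  intro h
  have h0 := thinCount_zero hcard
  rw [thinCount, card_eq_zero, filter_eq_empty_iff] at h0
  rw [mem_thinPlanes, h] at hp
  exact h0 (mem_univ _) hp

theorem neg_mem_thinPlanes (hp : p ∈ thinPlanes B) : -p ∈ thinPlanes B := by
  rw [mem_thinPlanes] at *
  rw [← hp, Prod.fst_neg, Prod.snd_neg, levelCard_neg, neg_neg]

theorem neg_ne_of_mem_thinPlanes (hcard : #B = 45) (hp : p ∈ thinPlanes B) : -p ≠ p := by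
  intro h
  refine ne_zero_of_mem_thinPlanes hcard hp ?_
  have h1 := three_nsmul_eq_zero' p.1
  have h2 : p.1 = -p.1 := congrArg Prod.fst h.symm
  rwa [eq_neg_iff_add_eq_zero.1 h2, zero_add] at h1

theorem thinCount_of_mem_thinPlanes (hB : CapFree B)
    (hD : Nat.card (Module.Dual (ZMod 3) W) = 243) (hcard : #B = 45) (hp : p ∈ thinPlanes B) :
    thinCount B p.1 = 1 := by
  have h := levelCard_and_thinCount hB hD hcard (ne_zero_of_mem_thinPlanes hcard hp) p.2
  rw [mem_thinPlanes.1 hp] at h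
  omega

theorem eq_of_mem_thinPlanes (hB : CapFree B)
    (hD : Nat.card (Module.Dual (ZMod 3) W) = 243) (hcard : #B = 45) (hp : p ∈ thinPlanes B)
    (hq : q ∈ thinPlanes B) (h : q.1 = p.1) : q = p := by
  obtain ⟨j, hj⟩ := card_eq_one.1 (thinCount_of_mem_thinPlanes hB hD hcard hp)
  have key : ∀ i, levelCard B p.1 i = 9 → i = j := fun i hi => by
    have : i ∈ ({j} : Finset (ZMod 3)) := by rw [← hj]; simpa using hi
    exact mem_singleton.1 this
  exact Prod.ext h ((key _ (h ▸ mem_thinPlanes.1 hq)).trans (key _ (mem_thinPlanes.1 hp)).symm)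

theorem notMem_adj_of_mem_thinPlanes (hB : CapFree B)
    (hD : Nat.card (Module.Dual (ZMod 3) W) = 243) (hcard : #B = 45) (hp : p ∈ thinPlanes B)
    (hq : q ∈ thinPlanes B) (h : ¬(q = p ∨ q = -p)) : p.1 ∉ adj ⊥ q.1 := by
  intro hmem
  obtain ⟨r, hr⟩ := mem_adj.1 hmem
  rw [Submodule.mem_bot, sub_eq_zero] at hr
  have hr3 : r = 0 ∨ r = 1 ∨ r = -1 := by clear hr; revert r; decide
  rcases hr3 with rfl | rfl | rfl
  · exact ne_zero_of_mem_thinPlanes hcard hp (by simpa using hr)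
  · exact h (Or.inl (eq_of_mem_thinPlanes hB hD hcard hp hq (by simpa using hr.symm)))
  · refine h (Or.inr (eq_of_mem_thinPlanes hB hD hcard (neg_mem_thinPlanes hp) hq ?_))
    rw [Prod.fst_neg, hr, dual_neg_one_smul, neg_neg]

/-- The pairs in a 45-cap not separated by two thin functionals are counted by the points of the
cap that lie on both thin planes. -/
theorem card_unseparated_of_ne (hB : CapFree B)
    (hD : Nat.card (Module.Dual (ZMod 3) W) = 243) (hcard : #B = 45) (hp : p ∈ thinPlanes B)
    (hq : q ∈ thinPlanes B) (h : ¬(q = p ∨ q = -p)) :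
    #{z ∈ B ×ˢ B | p.1 (z.1 - z.2) = 0 ∧ q.1 (z.1 - z.2) = 0} =
      243 + 18 * #{x ∈ B | p.1 x = p.2 ∧ q.1 x = q.2} := by
  have hind := notMem_adj_of_mem_thinPlanes hB hD hcard hp hq h
  have hq0 : q.1 ∉ (⊥ : Submodule (ZMod 3) (Module.Dual (ZMod 3) W)) := by
    simpa using ne_zero_of_mem_thinPlanes hcard hq
  have hqs := notMem_adj_sub_smul hq0 hind
  have hne : ∀ s : ZMod 3, p.1 - s • q.1 ≠ 0 := fun s hs =>
    sub_smul_notMem hind s ((Submodule.mem_bot _).2 hs)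
  have hn : #{x ∈ B | p.1 x = p.2 ∧ q.1 x = q.2} = levelCard (level B p.1 p.2) q.1 q.2 := by
    rw [levelCard, level, filter_filter]
  have hsq := card_four_directions (B ×ˢ B) (fun z => p.1 (z.1 - z.2)) fun z => q.1 (z.1 - z.2)
  simp only [← LinearMap.sub_apply, ← LinearMap.add_apply, ← sqSum_profile] at hsq
  have hlines := levelCard_add_levelCard B p.1 q.1 p.2 q.2
  have hsub : p.1 - (1 : ZMod 3) • q.1 = p.1 - q.1 := by rw [one_smul]
  have hadd : p.1 - (-1 : ZMod 3) • q.1 = p.1 + q.1 := by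
    rw [dual_neg_one_smul, sub_neg_eq_add]
  have hp1 := thinCount_of_mem_thinPlanes hB hD hcard hp
  have hq1 := thinCount_of_mem_thinPlanes hB hD hcard hq
  have key : ∀ s : ZMod 3, levelCard B (p.1 - s • q.1) (p.2 - s * q.2) = 18 →
      thinCount B (p.1 - s • q.1) = 1 → levelCard (level B p.1 p.2) q.1 q.2 ≠ 0 := by
    intro s h18 h1
    have := levelCard_level_ne_zero hB hD hcard h1 hq1 (hqs s) h18 q.2
    rwa [levelCard_level_sub_smul, sub_add_cancel, levelCard_level_comm] at this
  have key1 := key 1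
  have key2 := key (-1)
  rw [hsub, one_mul] at key1
  rw [hadd, neg_mul, one_mul, sub_neg_eq_add] at key2
  have t1 := levelCard_and_thinCount hB hD hcard (hsub ▸ hne 1) (p.2 - q.2)
  have t2 := levelCard_and_thinCount hB hD hcard (hadd ▸ hne (-1)) (p.2 + q.2)
  rw [sqSum_profile_eq hB hD hcard (ne_zero_of_mem_thinPlanes hcard hp), hp1,
    sqSum_profile_eq hB hD hcard (ne_zero_of_mem_thinPlanes hcard hq), hq1,
    sqSum_profile_eq hB hD hcard (hsub ▸ hne 1), sqSum_profile_eq hB hD hcard (hadd ▸ hne (-1)),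
    card_product, hcard] at hsq
  rw [mem_thinPlanes.1 hp, mem_thinPlanes.1 hq, hcard] at hlines
  rw [hn]
  omega

theorem card_unseparated [DecidableEq W] [DecidableEq (Module.Dual (ZMod 3) W × ZMod 3)]
    (hB : CapFree B)
    (hD : Nat.card (Module.Dual (ZMod 3) W) = 243) (hcard : #B = 45) (hp : p ∈ thinPlanes B)
    (hq : q ∈ thinPlanes B) :
    #{z ∈ B ×ˢ B | p.1 (z.1 - z.2) = 0 ∧ q.1 (z.1 - z.2) = 0} =
      243 + 18 * #{x ∈ B | p.1 x = p.2 ∧ q.1 x = q.2} +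
        324 * if q = p ∨ q = -p then 1 else 0 := by
  by_cases h : q = p ∨ q = -p
  · have h1 := sqSum_profile_eq hB hD hcard (ne_zero_of_mem_thinPlanes hcard hp)
    rw [thinCount_of_mem_thinPlanes hB hD hcard hp, sqSum_profile] at h1
    have h2 : #{x ∈ B | p.1 x = p.2} = 9 := mem_thinPlanes.1 hp
    rw [if_pos h]
    rcases h with rfl | rfl
    · simp only [and_self, h1, h2]
    · simp only [Prod.fst_neg, Prod.snd_neg, LinearMap.neg_apply, neg_eq_zero, neg_inj, and_self,
        h1, h2]
  · rw [card_unseparated_of_ne hB hD hcard hp hq h, if_neg h, mul_zero, add_zero]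

theorem sum_thinDirectionCount (hB : CapFree B)
    (hD : Nat.card (Module.Dual (ZMod 3) W) = 243) (hcard : #B = 45) :
    ∑ z ∈ B ×ˢ B, thinDirectionCount B (z.1 - z.2) = 80190 := by
  refine (sum_card_bipartiteAbove_eq_sum_card_bipartiteBelow (s := thinPlanes B) (t := B ×ˢ B)
    fun p z => p.1 (z.1 - z.2) = 0).symm.trans ?_
  change ∑ p ∈ thinPlanes B, #{z ∈ B ×ˢ B | p.1 (z.1 - z.2) = 0} = _
  rw [sum_congr rfl fun p hp => by
    rw [← sqSum_profile, sqSum_profile_eq hB hD hcard (ne_zero_of_mem_thinPlanes hcard hp),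
      thinCount_of_mem_thinPlanes hB hD hcard hp], sum_const, card_thinPlanes hB hD hcard]
  rfl

theorem sum_thinDirectionCount_sq (hB : CapFree B)
    (hD : Nat.card (Module.Dual (ZMod 3) W) = 243) (hcard : #B = 45) :
    ∑ z ∈ B ×ˢ B, thinDirectionCount B (z.1 - z.2) * thinDirectionCount B (z.1 - z.2) =
      3403620 := by
  classical
  have hsq : ∀ {ι κ : Type _} (s : Finset ι) (t : Finset κ) (R : κ → ι → Prop)
      [∀ k i, Decidable (R k i)], ∑ i ∈ s, #{k ∈ t | R k i} * #{k ∈ t | R k i} =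
        ∑ k ∈ t, ∑ l ∈ t, #{i ∈ s | R k i ∧ R l i} := by
    intro ι κ s t R _
    simp_rw [card_filter, sum_mul_sum, ite_and, ite_zero_mul, one_mul]
    rw [sum_comm]
    exact sum_congr rfl fun k _ => sum_comm
  have hpair : ∀ p ∈ thinPlanes B,
      ∑ q ∈ thinPlanes B, (if q = p ∨ q = -p then 1 else 0) = 2 := fun p hp => by
    rw [← card_filter, card_eq_two]
    refine ⟨p, -p, (neg_ne_of_mem_thinPlanes hcard hp).symm, ?_⟩
    ext q
    simp only [mem_filter, mem_insert, mem_singleton, and_iff_right_iff_imp]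
    rintro (rfl | rfl)
    exacts [hp, neg_mem_thinPlanes hp]
  have hthrough := hsq B (thinPlanes B) fun p x => p.1 x = p.2
  rw [sum_congr rfl fun x hx => by rw [card_thinPlanes_through hB hD hcard hx], sum_const, hcard]
    at hthrough
  unfold thinDirectionCount
  rw [hsq (B ×ˢ B) (thinPlanes B) fun p z => p.1 (z.1 - z.2) = 0,
    sum_congr rfl fun p hp => sum_congr rfl fun q hq => card_unseparated hB hD hcard hp hq]
  simp_rw [sum_add_distrib, ← mul_sum]
  rw [← hthrough, sum_congr rfl hpair]
  simp only [sum_const, card_thinPlanes hB hD hcard]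
  rfl

theorem thinDirectionCount_sub (hB : CapFree B)
    (hD : Nat.card (Module.Dual (ZMod 3) W) = 243) (hcard : #B = 45) {x y : W} (hx : x ∈ B)
    (hy : y ∈ B) (hxy : x ≠ y) : thinDirectionCount B (x - y) = 38 := by
  classical
  set K : W × W → ℤ := fun z => (thinDirectionCount B (z.1 - z.2) : ℤ)
  have h1 : ∑ z ∈ B ×ˢ B, K z = 80190 := by
    simp only [K]
    exact_mod_cast sum_thinDirectionCount hB hD hcard
  have h2 : ∑ z ∈ B ×ˢ B, K z * K z = 3403620 := by
    simp only [K]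
    exact_mod_cast sum_thinDirectionCount_sq hB hD hcard
  have h3 : ∑ z ∈ B ×ˢ B, (K z - 38) * (K z - 38) = 233280 := by
    have : ∀ z, (K z - 38) * (K z - 38) = K z * K z - 76 * K z + 1444 := fun z => by ring
    simp_rw [this]
    rw [sum_add_distrib, sum_sub_distrib, ← mul_sum, h1, h2, sum_const, card_product, hcard]
    norm_num
  have h4 : ∑ z ∈ B.diag, (K z - 38) * (K z - 38) = 233280 := by
    rw [sum_diag]
    simp only [K, sub_self]
    have : thinDirectionCount B 0 = 110 := by
      simp [thinDirectionCount, card_thinPlanes hB hD hcard]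
    rw [this, sum_const, hcard]
    norm_num
  rw [← diag_union_offDiag, sum_union (disjoint_diag_offDiag B), h4,
    add_eq_left, sum_eq_zero_iff_of_nonneg fun _ _ => mul_self_nonneg _] at h3
  have := h3 (x, y) (mem_offDiag.2 ⟨hx, hy, hxy⟩)
  rw [mul_self_eq_zero, sub_eq_zero] at this
  simp only [K] at this
  exact_mod_cast this

theorem repCount_eq_zero_or [DecidableEq W] (hB : CapFree B)
    (hD : Nat.card (Module.Dual (ZMod 3) W) = 243) (hcard : #B = 45) {d : W} (hd : d ≠ 0) :
    repCount B d = 0 ∨ repCount B d = 9 := by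
  refine or_iff_not_imp_left.2 fun h => ?_
  obtain ⟨x, hx⟩ := card_ne_zero.1 h
  rw [mem_filter] at hx
  have h1 := thinDirectionCount_sub hB hD hcard hx.2 hx.1 (by simpa using hd)
  rw [add_sub_cancel_left, thinDirectionCount_eq hB hD hcard hd] at h1
  omega

theorem card_nonDifferences [DecidableEq W] [Fintype W] (hB : CapFree B)
    (hD : Nat.card (Module.Dual (ZMod 3) W) = 243) (hW : Fintype.card W = 243)
    (hcard : #B = 45) : #(nonDifferences B) = 22 := by
  have h0 : repCount B 0 = 45 := by simp [repCount, hcard]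
  have h1 : ∀ d, repCount B d + 9 * (if d ∈ nonDifferences B then 1 else 0) =
      9 + if d = 0 then 36 else 0 := fun d => by
    simp only [mem_nonDifferences_iff_repCount]
    by_cases hd : d = 0
    · simp [hd, h0]
    · rcases repCount_eq_zero_or hB hD hcard hd with h | h <;> simp [h, hd]
  have h2 := sum_congr (rfl : (univ : Finset W) = _) fun d _ => h1 d
  rw [sum_add_distrib, sum_add_distrib, ← mul_sum, sum_repCount, sum_ite_eq', if_pos (mem_univ _),
    sum_const, card_univ, hW, hcard, ← card_filter, filter_mem_eq_inter, univ_inter,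
    smul_eq_mul] at h2
  omega

theorem capFree_nonDifferences [DecidableEq W] [Fintype W] (hB : CapFree B)
    (hD : Nat.card (Module.Dual (ZMod 3) W) = 243) (hcard : #B = 45) :
    CapFree (nonDifferences B) := by
  intro a ha b hb c hc hab _ _ h
  have hK : ∀ d ∈ nonDifferences B, thinDirectionCount B d = 20 := fun d hd => by
    rw [thinDirectionCount_eq hB hD hcard (ne_zero_of_mem_nonDifferences hcard hd),
      mem_nonDifferences_iff_repCount.1 hd]
  have h1 := card_four_directions (thinPlanes B) (fun p => p.1 a) fun p => p.1 b
  simp only [← map_sub, ← map_add, ← thinDirectionCount.eq_1] at h1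
  have hab' := sub_ne_zero.2 hab
  rw [hK a ha, hK b hb, eq_neg_of_add_eq_zero_left h, thinDirectionCount_neg, hK c hc,
    card_thinPlanes hB hD hcard, thinDirectionCount_eq hB hD hcard hab'] at h1
  have h2 := repCount_eq_zero_or hB hD hcard hab'
  omega

end ReflectionComplement

section Reflection

theorem finrank_ker_eq_five {ℓ : (Fin 6 → ZMod 3) →ₗ[ZMod 3] ZMod 3} (hℓ : ℓ ≠ 0) :
    Module.finrank (ZMod 3) (LinearMap.ker ℓ) = 5 := by
  have h := LinearMap.finrank_range_add_finrank_ker ℓ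
  rw [LinearMap.range_eq_top.2 (LinearMap.surjective hℓ), finrank_top, Module.finrank_self,
    Module.finrank_fin_fun] at h
  omega

/-- Three elements of `ZMod 3` with sum zero are all zero, all nonzero, or distinct. -/
theorem zmod_three_sum_eq_zero : ∀ i j k : ZMod 3, i + j + k = 0 →
    (i = 0 ∧ j = 0 ∧ k = 0) ∨ (i ≠ 0 ∧ j ≠ 0 ∧ k ≠ 0) ∨
    (i = 0 ∧ j = 1 ∧ k = 2) ∨ (i = 0 ∧ k = 1 ∧ j = 2) ∨ (j = 0 ∧ i = 1 ∧ k = 2) ∨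
    (j = 0 ∧ k = 1 ∧ i = 2) ∨ (k = 0 ∧ i = 1 ∧ j = 2) ∨ (k = 0 ∧ j = 1 ∧ i = 2) := by
  decide

end Reflection

/-- If two parallel hyperplane slices of a 6-dimensional cap are 45-caps that are
point reflections of each other, then the middle slice has at most 22 points and the
cap is contained in a 112-cap. -/
theorem reflection_case_extends_to_112 (S : Finset (Fin 6 → ZMod 3)) (hS : IsCap S)
    (ℓ : (Fin 6 → ZMod 3) →ₗ[ZMod 3] ZMod 3) (hℓ : ℓ ≠ 0)
    (h1 : (S.filter fun x => ℓ x = 1).card = 45)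
    (h2 : (S.filter fun x => ℓ x = 2).card = 45)
    (hrefl : ∃ c : Fin 6 → ZMod 3, ℓ c = 0 ∧
      (S.filter fun x => ℓ x = 2) = (S.filter fun x => ℓ x = 1).image (fun x => c - x)) :
    (S.filter fun x => ℓ x = 0).card ≤ 22 ∧
    ∃ T : Finset (Fin 6 → ZMod 3), IsCap T ∧ T.card = 112 ∧ S ⊆ T := by
  classical
  obtain ⟨c, hc, hrefl⟩ := hrefl
  obtain ⟨v, hv⟩ := LinearMap.surjective hℓ 1
  have := Module.finite_of_finite (ZMod 3) (M := Module.Dual (ZMod 3) (LinearMap.ker ℓ))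
  have := Fintype.ofFinite (Module.Dual (ZMod 3) (LinearMap.ker ℓ))
  have hD : Nat.card (Module.Dual (ZMod 3) (LinearMap.ker ℓ)) = 243 := by
    rw [Module.natCard_eq_pow_finrank (K := ZMod 3), Subspace.dual_finrank_eq,
      finrank_ker_eq_five hℓ, Nat.card_zmod]
    norm_num
  have hW : Fintype.card (LinearMap.ker ℓ) = 243 := by
    rw [Module.card_eq_pow_finrank (K := ZMod 3), finrank_ker_eq_five hℓ, ZMod.card]
    norm_num
  set A : Finset (LinearMap.ker ℓ) := {x | (x : Fin 6 → ZMod 3) + v ∈ S} with hA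
  have mem_A : ∀ x, x ∈ A ↔ (x : Fin 6 → ZMod 3) + v ∈ S := by simp [hA]
  have hcard : #A = 45 := by
    rw [← h1]
    refine card_bij (fun x _ => (x : Fin 6 → ZMod 3) + v) (fun x hx => ?_)
      (fun x _ y _ h => Subtype.ext (add_right_cancel h)) fun y hy => ?_
    · exact mem_filter.2 ⟨(mem_A x).1 hx, by rw [map_add, LinearMap.mem_ker.1 x.2, hv, zero_add]⟩
    · rw [mem_filter] at hy
      exact ⟨⟨y - v, by rw [LinearMap.mem_ker, map_sub, hy.2, hv, sub_self]⟩,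
        (mem_A _).2 (by simpa using hy.1), sub_add_cancel y v⟩
  have hB : CapFree A := fun x hx y hy z hz hxy hxz hyz h => by
    refine hS _ ((mem_A x).1 hx) _ ((mem_A y).1 hy) _ ((mem_A z).1 hz) (by simpa using hxy)
      (by simpa using hxz) (by simpa using hyz) ?_
    have h' : (x + y + z : Fin 6 → ZMod 3) = 0 := congrArg Subtype.val h
    calc (x + v + (y + v) + (z + v) : Fin 6 → ZMod 3) = x + y + z + (v + v + v) := by abel
      _ = 0 := by rw [h', three_nsmul_eq_zero', add_zero]
  set R : Finset (Fin 6 → ZMod 3) :=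
    (nonDifferences A).image fun e : LinearMap.ker ℓ => (e : Fin 6 → ZMod 3) - c
  have hRcard : #R = 22 := by
    rw [card_image_of_injective _ fun x y h => Subtype.ext (sub_left_injective h),
      card_nonDifferences hB hD hW hcard]
  have hRℓ : ∀ z ∈ R, ℓ z = 0 := fun z hz => by
    obtain ⟨e, -, rfl⟩ := mem_image.1 hz
    rw [map_sub, hc, LinearMap.mem_ker.1 e.2, sub_zero]
  have hRcap : IsCap R := fun x hx y hy z hz hxy hxz hyz h => by
    obtain ⟨e, he, rfl⟩ := mem_image.1 hx
    obtain ⟨f, hf, rfl⟩ := mem_image.1 hy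
    obtain ⟨g, hg, rfl⟩ := mem_image.1 hz
    refine capFree_nonDifferences hB hD hcard e he f hf g hg (fun h => hxy (by rw [h]))
      (fun h => hxz (by rw [h])) (fun h => hyz (by rw [h])) (Subtype.ext ?_)
    change (e + f + g : Fin 6 → ZMod 3) = 0
    calc (e + f + g : Fin 6 → ZMod 3) = (e - c) + (f - c) + (g - c) + (c + c + c) := by abel
      _ = 0 := by rw [h, three_nsmul_eq_zero', add_zero]
  have hne : ∀ {x y}, ℓ x ≠ ℓ y → x ≠ y := fun h h' => h (congrArg ℓ h')
  have hSR : ∀ z ∈ S, ℓ z = 0 → z ∈ R := fun z hz hz0 => by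
    refine mem_image.2 ⟨⟨z + c, by rw [LinearMap.mem_ker, map_add, hz0, hc, add_zero]⟩, ?_,
      add_sub_cancel_right z c⟩
    refine mem_nonDifferences.2 fun x hx hxz => ?_
    rw [mem_A] at hx hxz
    set y : Fin 6 → ZMod 3 := x + (z + c) + v with hy
    replace hxz : y ∈ S := hxz
    have hx1 : ℓ (x + v) = 1 := by rw [map_add, LinearMap.mem_ker.1 x.2, hv, zero_add]
    have hy1 : ℓ y = 1 := by
      rw [hy, map_add, map_add, map_add, hz0, hc, LinearMap.mem_ker.1 x.2, hv]
      rfl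
    have hyr : c - y ∈ S.filter fun x => ℓ x = 2 :=
      hrefl ▸ mem_image_of_mem _ (mem_filter.2 ⟨hxz, hy1⟩)
    obtain ⟨hyS, hy2⟩ := mem_filter.1 hyr
    refine hS _ hx _ hyS _ hz (hne ?_) (hne ?_) (hne ?_) ?_
    · rw [hx1, hy2]; decide
    · rw [hx1, hz0]; decide
    · rw [hy2, hz0]; decide
    · rw [hy]; abel
  have hmix : ∀ x ∈ R, ∀ y ∈ S, ∀ z ∈ S, ℓ y = 1 → ℓ z = 2 → x + y + z ≠ 0 := by
    intro x hx y hy z hz hy1 hz2 h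
    obtain ⟨e, he, rfl⟩ := mem_image.1 hx
    obtain ⟨y', hy', rfl⟩ := mem_image.1 (hrefl ▸ mem_filter.2 ⟨hz, hz2⟩)
    refine mem_nonDifferences.1 he
      ⟨y - v, by rw [LinearMap.mem_ker, map_sub, hy1, hv, sub_self]⟩ ((mem_A _).2 ?_)
      ((mem_A _).2 ?_)
    · simpa using hy
    · have : y' = y - v + e + v := by
        rw [← sub_eq_zero, ← neg_eq_zero, ← h]
        abel
      exact this ▸ (mem_filter.1 hy').1
  have hTR : ∀ z ∈ S ∪ R, ℓ z = 0 → z ∈ R := fun z hz hz0 =>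
    (mem_union.1 hz).elim (fun h => hSR z h hz0) id
  have hTS : ∀ z ∈ S ∪ R, ℓ z ≠ 0 → z ∈ S := fun z hz hz0 =>
    (mem_union.1 hz).elim id fun h => absurd (hRℓ z h) hz0
  have h10 : (1 : ZMod 3) ≠ 0 := by decide
  have h20 : (2 : ZMod 3) ≠ 0 := by decide
  refine ⟨hRcard ▸ card_le_card fun z hz => hSR z (mem_filter.1 hz).1 (mem_filter.1 hz).2,
    S ∪ R, ?_, ?_, subset_union_left⟩
  · have hT : ∀ x ∈ S ∪ R, ∀ y ∈ S ∪ R, ∀ z ∈ S ∪ R, ℓ x = 0 → ℓ y = 1 → ℓ z = 2 →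
        x + y + z ≠ 0 := fun x hx y hy z hz hx0 hy1 hz2 =>
      hmix x (hTR x hx hx0) y (hTS y hy (hy1 ▸ h10)) z (hTS z hz (hz2 ▸ h20)) hy1 hz2
    intro x hx y hy z hz hxy hxz hyz h
    have hsum : ℓ x + ℓ y + ℓ z = 0 := by rw [← map_add, ← map_add, h, map_zero]
    rcases zmod_three_sum_eq_zero _ _ _ hsum with
      h' | h' | h' | h' | h' | h' | h' | h' <;> obtain ⟨ha, hb, hc⟩ := h'
    · exact hRcap x (hTR x hx ha) y (hTR y hy hb) z (hTR z hz hc) hxy hxz hyz h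
    · exact hS x (hTS x hx ha) y (hTS y hy hb) z (hTS z hz hc) hxy hxz hyz h
    · exact hT x hx y hy z hz ha hb hc h
    · exact hT x hx z hz y hy ha hb hc (by rw [← h]; abel)
    · exact hT y hy x hx z hz ha hb hc (by rw [← h]; abel)
    · exact hT y hy z hz x hx ha hb hc (by rw [← h]; abel)
    · exact hT z hz x hx y hy ha hb hc (by rw [← h]; abel)
    · exact hT z hz y hy x hx ha hb hc (by rw [← h]; abel)
  · have hu : S ∪ R = ({x ∈ S | ℓ x = 1} ∪ {x ∈ S | ℓ x = 2}) ∪ R := by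
      have h3 : ∀ i : ZMod 3, i = 0 ∨ i = 1 ∨ i = 2 := by decide
      ext z
      simp only [mem_union, mem_filter]
      rcases h3 (ℓ z) with h | h | h
      · have := hSR z
        tauto
      · tauto
      · tauto
    rw [hu, card_union_of_disjoint, card_union_of_disjoint, h1, h2, hRcard]
    · exact disjoint_filter.2 fun z _ h h' => absurd (h.symm.trans h') (by decide)
    · refine disjoint_left.2 fun z hz hzR => ?_
      simp only [mem_union, mem_filter, hRℓ z hzR] at hz
      rcases hz with h | h
      · exact h10 h.2.symm
      · exact h20 h.2.symm
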